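/- arXiv:2109.14100 — 8 statements merged into one kernel-verified Lean document; each statement's English description precedes it below -/
import Mathlib

section
/- Let k be a field, let n ≥ 1, and let f₁, f₂ be homogeneous polynomials of the same positive degree d in k[x₁,…,xₙ]. Suppose that for every pair (c₁,c₂) ∈ k² with (c₁,c₂) ≠ (0,0), the combination c₁f₁ + c₂f₂ is nonzero and cannot be written as a product g·h of two homogeneous polynomials g, h of positive degree. Then f₁, f₂ is a regular sequence on k[x₁,…,xₙ]. -/
open MvPolynomial

/-- The component of degree `a + b` of a product of polynomials of degrees at most `a` and `b`
is the product of their components of degrees `a` and `b`. -/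
theorem MvPolynomial.homogeneousComponent_add_mul {σ R : Type*} [CommSemiring R]
    {g h : MvPolynomial σ R} {a b : ℕ} (hg : g.totalDegree ≤ a) (hh : h.totalDegree ≤ b) :
    homogeneousComponent (a + b) (g * h) =
      homogeneousComponent a g * homogeneousComponent b h := by
  classical
  ext m
  by_cases hm : m.degree = a + b
  · rw [coeff_homogeneousComponent, if_pos hm, coeff_mul, coeff_mul]
    refine Finset.sum_congr rfl fun x hx => ?_
    have hxm : x.1.degree + x.2.degree = a + b := by
      rw [← hm, ← Finset.HasAntidiagonal.mem_antidiagonal.mp hx, map_add]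
    rw [coeff_homogeneousComponent, coeff_homogeneousComponent]
    rcases lt_trichotomy x.1.degree a with hlt | heq | hgt
    · have hz : coeff x.2 h = 0 := coeff_eq_zero_of_totalDegree_lt (by
        rw [← Finsupp.degree_apply]
        lia)
      simp [hz]
    · rw [if_pos heq, if_pos (by lia)]
    · have hz : coeff x.1 g = 0 := coeff_eq_zero_of_totalDegree_lt (by
        rw [← Finsupp.degree_apply]
        lia)
      simp [hz]
  · rw [coeff_homogeneousComponent, if_neg hm]
    exact (((homogeneousComponent_isHomogeneous a g).mul
      (homogeneousComponent_isHomogeneous b h)).coeff_eq_zero hm).symm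

/-- A nonzero form of positive degree over a field is irreducible if it is not a product of two
forms of positive degree. -/
theorem MvPolynomial.IsHomogeneous.irreducible_of_forall_ne_mul {σ k : Type*} [Field k]
    {f : MvPolynomial σ k} {d : ℕ} (hd : 0 < d) (hf : f.IsHomogeneous d) (hf0 : f ≠ 0)
    (H : ¬ ∃ (g h : MvPolynomial σ k) (e₁ e₂ : ℕ), 0 < e₁ ∧ 0 < e₂ ∧
      g.IsHomogeneous e₁ ∧ h.IsHomogeneous e₂ ∧ f = g * h) : Irreducible f := by
  have unit_of_degree : ∀ p : MvPolynomial σ k, p ≠ 0 → p.totalDegree = 0 → IsUnit p := by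
    intro p hp hdeg
    rw [totalDegree_eq_zero_iff_eq_C] at hdeg
    rw [hdeg] at hp ⊢
    exact (IsUnit.mk0 _ fun hz => hp (by rw [hz, C_0])).map C
  refine ⟨fun hu => ?_, fun g h hfgh => ?_⟩
  · have := (isUnit_iff_totalDegree_of_isReduced.mp hu).2
    rw [hf.totalDegree hf0] at this
    lia
  · have hg0 : g ≠ 0 := by rintro rfl; simp [hfgh] at hf0
    have hh0 : h ≠ 0 := by rintro rfl; simp [hfgh] at hf0
    by_contra! hu
    refine H ⟨_, _, g.totalDegree, h.totalDegree,
      Nat.pos_of_ne_zero fun hz => hu.1 (unit_of_degree g hg0 hz),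
      Nat.pos_of_ne_zero fun hz => hu.2 (unit_of_degree h hh0 hz),
      homogeneousComponent_isHomogeneous _ g, homogeneousComponent_isHomogeneous _ h, ?_⟩
    rw [← homogeneousComponent_add_mul le_rfl le_rfl, ← hfgh,
      ← totalDegree_mul_of_isDomain hg0 hh0, ← hfgh, hf.totalDegree hf0]
    exact (homogeneousComponent_eq_self hf).symm

/-- If `p` is prime, `p ∤ q` and `p, q` generate a proper ideal, then `p, q` is a regular
sequence. -/
theorem Prime.isRegular_pair {R : Type*} [CommRing R] [IsDomain R] {p q : R} (hp : Prime p)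
    (hpq : ¬ p ∣ q) (htop : Ideal.span {p, q} ≠ ⊤) :
    RingTheory.Sequence.IsRegular R [p, q] := by
  refine ⟨⟨fun i hi => ?_⟩, ?_⟩
  · rw [isSMulRegular_quotient_iff_mem_of_smul_mem]
    intro x hx
    match i, hi with
    | 0, _ => simpa [hp.ne_zero] using hx
    | 1, _ =>
      simp only [List.take_succ_cons, List.take_zero, Ideal.ofList_singleton, smul_eq_mul,
        Ideal.mul_top, Ideal.mem_span_singleton, List.getElem_cons_succ,
        List.getElem_cons_zero] at hx ⊢
      exact (hp.dvd_or_dvd hx).resolve_left hpq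
  · rw [smul_eq_mul, Ideal.mul_top, Ideal.ofList_cons, Ideal.ofList_singleton,
      ← Ideal.span_insert]
    exact htop.symm

/-- If `f₁, f₂` are homogeneous of the same positive degree `d` and every
nontrivial `k`-linear combination of them is nonzero and does not factor as a product of two
homogeneous polynomials of positive degree (collective strength ≥ 1), then `f₁, f₂` is a
regular sequence on `k[x₁,…,xₙ]`. -/
theorem stmt_1 {k : Type*} [Field k] (n : ℕ) (hn : 1 ≤ n) (d : ℕ) (hd : 0 < d)
    (f₁ f₂ : MvPolynomial (Fin n) k)
    (hf₁ : f₁.IsHomogeneous d) (hf₂ : f₂.IsHomogeneous d)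
    (hstr : ∀ c₁ c₂ : k, (c₁, c₂) ≠ (0, 0) →
      c₁ • f₁ + c₂ • f₂ ≠ 0 ∧
      ¬ ∃ (g h : MvPolynomial (Fin n) k) (e₁ e₂ : ℕ), 0 < e₁ ∧ 0 < e₂ ∧
          g.IsHomogeneous e₁ ∧ h.IsHomogeneous e₂ ∧ c₁ • f₁ + c₂ • f₂ = g * h) :
    RingTheory.Sequence.IsRegular (MvPolynomial (Fin n) k) [f₁, f₂] := by
  have hne : ∀ c₁ c₂ : k, (c₁, c₂) ≠ (0, 0) → c₁ • f₁ + c₂ • f₂ ≠ 0 :=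
    fun c₁ c₂ hc => (hstr c₁ c₂ hc).1
  have h₁ : f₁ ≠ 0 := by simpa using hne 1 0 (by simp)
  have h₂ : f₂ ≠ 0 := by simpa using hne 0 1 (by simp)
  have hirr : Irreducible f₁ :=
    hf₁.irreducible_of_forall_ne_mul hd h₁ (by simpa using (hstr 1 0 (by simp)).2)
  refine hirr.prime.isRegular_pair ?_ ?_
  · rintro ⟨c, hc⟩
    have hc0 : c ≠ 0 := by rintro rfl; simp [hc] at h₂
    have hdeg := totalDegree_mul_of_isDomain h₁ hc0
    rw [← hc, hf₁.totalDegree h₁, hf₂.totalDegree h₂] at hdeg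
    have hC := totalDegree_eq_zero_iff_eq_C.mp (show c.totalDegree = 0 by lia)
    refine hne (coeff 0 c) (-1) (by simp) ?_
    rw [hc, smul_eq_C_mul, ← hC, neg_one_smul]
    ring
  · have hle : Ideal.span {f₁, f₂} ≤ RingHom.ker (constantCoeff (σ := Fin n) (R := k)) := by
      rw [Ideal.span_le, Set.pair_subset_iff]
      exact ⟨hf₁.coeff_eq_zero (by simpa using hd.ne), hf₂.coeff_eq_zero (by simpa using hd.ne)⟩
    exact ne_top_of_le_ne_top (RingHom.ker_ne_top _) hle
end

section
/- Let k be an algebraically closed field, let n ≥ 1, and let f₁, f₂ be homogeneous polynomials of positive degree in k[x₁,…,xₙ]. Let J be the ideal of k[x₁,…,xₙ] generated by f₁, f₂ together with all 2×2 minors of the 2×n Jacobian matrix whose (i,j) entry is ∂f_i/∂x_j. If the height of J is strictly greater than 4, then the ideal (f₁, f₂) is prime. -/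
open MvPolynomial

/-- The height (codimension) of an ideal: the infimum of the heights of the prime ideals
containing it. -/
noncomputable def idealHeight {R : Type*} [CommRing R] (I : Ideal R) : ℕ∞ :=
  ⨅ p ∈ {p : PrimeSpectrum R | I ≤ p.asIdeal}, Order.height p

section RegularLocalRing

open IsLocalRing

variable {A : Type*} [CommRing A]

lemma spanFinrank_maximalIdeal_quotient_add_one_le [IsLocalRing A] [IsNoetherianRing A] {t : A}
    (ht : t ∈ maximalIdeal A) (ht2 : t ∉ maximalIdeal A ^ 2) [IsLocalRing (A ⧸ Ideal.span {t})] :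
    (maximalIdeal (A ⧸ Ideal.span {t})).spanFinrank + 1 ≤ (maximalIdeal A).spanFinrank := by
  classical
  have fg : (maximalIdeal A).FG := (maximalIdeal A).fg_of_isNoetherianRing
  have hfin := Submodule.FG.finite_generators fg
  set G : Finset A := hfin.toFinset with hG
  have hspan : Submodule.span A (G : Set A) = maximalIdeal A := by
    rw [hG, hfin.coe_toFinset]; exact Submodule.span_generators _
  have hGm (g) (hg : g ∈ G) : g ∈ maximalIdeal A := hspan ▸ Submodule.subset_span hg
  obtain ⟨c, -, hc⟩ := Submodule.mem_span_finset.mp (hspan ▸ ht)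
  obtain ⟨g, hg, hcg⟩ : ∃ g ∈ G, c g ∉ maximalIdeal A := by
    by_contra! h
    refine ht2 (hc ▸ sum_mem fun g hg ↦ ?_)
    rw [pow_two]
    exact Ideal.mul_mem_mul (h g hg) (hGm g hg)
  have hunit : IsUnit (c g) := by simpa using hcg
  have hcard : (G.erase g).card + 1 = (maximalIdeal A).spanFinrank := by
    rw [Finset.card_erase_add_one hg, ← Submodule.FG.generators_ncard fg,
      Set.ncard_eq_toFinset_card _ hfin]
  rw [← hcard]
  let π := Ideal.Quotient.mk (Ideal.span {t})
  have hπ : Function.Surjective π := Ideal.Quotient.mk_surjective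
  have hgspan : π g ∈ Ideal.span (π '' (G.erase g : Set A)) := by
    have h1 : π (c g) * π g = - ∑ x ∈ G.erase g, π (c x) * π x := by
      have h0 : π t = 0 := Ideal.Quotient.eq_zero_iff_mem.mpr (Ideal.mem_span_singleton_self t)
      have h2 := congrArg π hc
      rw [h0, ← Finset.add_sum_erase _ _ hg] at h2
      simp only [smul_eq_mul, map_add, map_mul, map_sum] at h2
      exact eq_neg_of_add_eq_zero_left h2
    rw [← Ideal.unit_mul_mem_iff_mem _ (hunit.map π), h1]
    exact neg_mem (sum_mem fun x hx ↦ Ideal.mul_mem_left _ _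
      (Ideal.subset_span (Set.mem_image_of_mem _ hx)))
  have hle : maximalIdeal (A ⧸ Ideal.span {t}) = Ideal.span (π '' (G.erase g : Set A)) := by
    rw [← IsLocalRing.map_maximalIdeal_of_surjective π hπ, ← hspan]
    change Ideal.map π (Ideal.span _) = _
    rw [Ideal.map_span]
    apply le_antisymm
    · rw [Ideal.span_le]
      rintro _ ⟨x, hx, rfl⟩
      by_cases hxg : x = g
      · exact hxg ▸ hgspan
      · exact Ideal.subset_span ⟨x, by simpa [hxg] using hx, rfl⟩
    · exact Ideal.span_mono (Set.image_mono (by simp))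
  rw [hle]
  gcongr
  refine (Submodule.spanFinrank_span_le_ncard_of_finite ((Finset.finite_toSet _).image _)).trans ?_
  refine (Set.ncard_image_le (Finset.finite_toSet _)).trans ?_
  rw [Set.ncard_coe_finset]

lemma IsRegularLocalRing.quotient_span_singleton [IsRegularLocalRing A] {t : A}
    (ht : t ∈ maximalIdeal A) (ht2 : t ∉ maximalIdeal A ^ 2) :
    IsRegularLocalRing (A ⧸ Ideal.span {t}) := by
  have : Nontrivial (A ⧸ Ideal.span {t}) :=
    Ideal.Quotient.nontrivial_iff.mpr (by simpa [Ideal.span_singleton_eq_top] using ht)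
  have : IsLocalRing (A ⧸ Ideal.span {t}) :=
    .of_surjective' (Ideal.Quotient.mk _) Ideal.Quotient.mk_surjective
  apply IsRegularLocalRing.of_spanFinrank_maximalIdeal_le
  have h1 := spanFinrank_maximalIdeal_quotient_add_one_le ht ht2
  have h2 := Ideal.height_le_ringKrullDim_quotient_add_one ht
  rw [maximalIdeal_height_eq_ringKrullDim, ← (isRegularLocalRing_iff A).mp ‹_›] at h2
  have h3 : (((maximalIdeal (A ⧸ Ideal.span {t})).spanFinrank + 1 : ℕ) : WithBot ℕ∞) ≤
      ringKrullDim (A ⧸ Ideal.span {t}) + 1 := le_trans (by exact_mod_cast h1) h2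
  push_cast at h3
  exact (ENat.WithBot.add_le_add_one_right_iff).mp h3

lemma IsRegularLocalRing.isDomain [IsRegularLocalRing A] : IsDomain A := by
  obtain ⟨d, hd⟩ : ∃ d, (maximalIdeal A).spanFinrank = d := ⟨_, rfl⟩
  induction d generalizing A with
  | zero =>
    have : maximalIdeal A = ⊥ :=
      (Submodule.spanFinrank_eq_zero_iff_eq_bot (maximalIdeal A).fg_of_isNoetherianRing).mp hd
    exact ((IsLocalRing.isField_iff_maximalIdeal_eq).mpr this).isDomain
  | succ d ih =>
    classical
    have hdim := (isRegularLocalRing_iff A).mp ‹_›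
    obtain ⟨t, ht, ht2, htmin⟩ : ∃ t ∈ maximalIdeal A, t ∉ maximalIdeal A ^ 2 ∧
        ∀ q ∈ minimalPrimes A, t ∉ q := by
      by_contra! h
      have hfin := minimalPrimes.finite_of_isNoetherianRing A
      have hsub : (maximalIdeal A : Set A) ⊆
          ⋃ i ∈ ((insert (maximalIdeal A ^ 2) hfin.toFinset : Finset (Ideal A)) : Set (Ideal A)),
            ((id i : Ideal A) : Set A) := by
        intro t ht
        simp only [Set.mem_iUnion]
        by_cases ht2 : t ∈ maximalIdeal A ^ 2
        · exact ⟨_, by simp, ht2⟩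
        · obtain ⟨q, hq, htq⟩ := h t ht ht2
          exact ⟨q, by simp [hq], htq⟩
      obtain ⟨q, hq, hle⟩ := (Ideal.subset_union_prime (maximalIdeal A ^ 2) (maximalIdeal A ^ 2)
        (fun i hi h1 _ ↦ by
          have : i ∈ minimalPrimes A := by simpa [h1] using hi
          exact Ideal.IsMinimalPrime.isPrime this)).mp hsub
      rcases Finset.mem_insert.mp hq with rfl | hq
      · have h0 : maximalIdeal A = ⊥ := by
          refine Submodule.eq_bot_of_le_smul_of_le_jacobson_bot (maximalIdeal A) _
            (maximalIdeal A).fg_of_isNoetherianRing ?_ (IsLocalRing.maximalIdeal_le_jacobson _)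
          simpa [pow_two] using hle
        rw [h0] at hd
        simp at hd
      · have hq : q ∈ minimalPrimes A := by simpa using hq
        have hqp := hq.isPrime
        have heq : q = maximalIdeal A :=
          le_antisymm (IsLocalRing.le_maximalIdeal hqp.ne_top) hle
        have := (Ideal.height_eq_zero_iff (I := q)).mpr hq
        rw [heq] at this
        rw [← maximalIdeal_height_eq_ringKrullDim, this, hd] at hdim
        norm_cast at hdim
    have hreg := IsRegularLocalRing.quotient_span_singleton ht ht2
    have hdom : IsDomain (A ⧸ Ideal.span {t}) := by
      have h1 := spanFinrank_maximalIdeal_quotient_add_one_le ht ht2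
      have h2 := Ideal.height_le_ringKrullDim_quotient_add_one ht
      rw [maximalIdeal_height_eq_ringKrullDim, ← hdim,
        ← (isRegularLocalRing_iff _).mp hreg] at h2
      norm_cast at h2
      exact ih (by omega)
    have hprime : (Ideal.span {t}).IsPrime := (Ideal.Quotient.isDomain_iff_prime _).mp hdom
    obtain ⟨q, hq, hqt⟩ :=
      Ideal.exists_minimalPrimes_le (I := (⊥ : Ideal A)) (J := Ideal.span {t}) bot_le
    have hqp := hq.isPrime
    have hq0 : q = ⊥ := by
      refine Submodule.eq_bot_of_le_smul_of_le_jacobson_bot (Ideal.span {t}) _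
        q.fg_of_isNoetherianRing ?_
        (((Ideal.span_singleton_le_iff_mem _).mpr ht).trans
          (IsLocalRing.maximalIdeal_le_jacobson _))
      intro x hx
      obtain ⟨y, rfl⟩ := Ideal.mem_span_singleton'.mp (hqt hx)
      rw [mul_comm, smul_eq_mul]
      exact Ideal.mul_mem_mul (Ideal.mem_span_singleton_self t)
        ((hqp.mem_or_mem hx).resolve_right (htmin q hq))
    rw [hq0] at hqp
    exact IsDomain.of_bot_isPrime A

end RegularLocalRing

section Jacobian

variable {σ k : Type*} [Field k] {f₁ f₂ : MvPolynomial σ k} {P : Ideal (MvPolynomial σ k)}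

lemma derivation_mem_of_mem_sq {A : Type*} [CommRing A] {R : Type*} [CommRing R] [Algebra A R]
    (D : Derivation A R R) {P : Ideal R} {x : R} (hx : x ∈ P ^ 2) : D x ∈ P := by
  rw [pow_two] at hx
  induction hx using Submodule.mul_induction_on' with
  | mem_mul_mem a ha b hb =>
    rw [D.leibniz]
    exact add_mem (P.mul_mem_right _ ha) (P.mul_mem_right _ hb)
  | add x _ y _ hx hy => rw [map_add]; exact add_mem hx hy

lemma mem_and_mem_of_add_mem_sq [P.IsPrime] (h₁ : f₁ ∈ P) (h₂ : f₂ ∈ P) {i j : σ}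
    (hij : pderiv i f₁ * pderiv j f₂ - pderiv j f₁ * pderiv i f₂ ∉ P)
    {u v : MvPolynomial σ k} (h : u * f₁ + v * f₂ ∈ P ^ 2) : u ∈ P ∧ v ∈ P := by
  have key (l : σ) : u * pderiv l f₁ + v * pderiv l f₂ ∈ P := by
    have := derivation_mem_of_mem_sq (pderiv l) h
    simp only [map_add, Derivation.leibniz, smul_eq_mul] at this
    have h3 : f₁ * pderiv l u + f₂ * pderiv l v ∈ P :=
      add_mem (P.mul_mem_right _ h₁) (P.mul_mem_right _ h₂)
    convert sub_mem this h3 using 1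
    ring
  constructor
  · refine (‹P.IsPrime›.mem_or_mem ?_).resolve_right hij
    convert sub_mem (P.mul_mem_left (pderiv j f₂) (key i))
      (P.mul_mem_left (pderiv i f₂) (key j)) using 1
    ring
  · refine (‹P.IsPrime›.mem_or_mem ?_).resolve_right hij
    convert sub_mem (P.mul_mem_left (pderiv i f₁) (key j))
      (P.mul_mem_left (pderiv j f₁) (key i)) using 1
    ring

open IsLocalRing in
lemma exists_notMem_mul_mem_span_pair_of_isRegularLocalRing [P.IsPrime]
    (S : Type*) [CommRing S] [Algebra (MvPolynomial σ k) S] [IsLocalization.AtPrime S P]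
    [IsRegularLocalRing S] (h₁ : f₁ ∈ P) (h₂ : f₂ ∈ P) {i j : σ}
    (hij : pderiv i f₁ * pderiv j f₂ - pderiv j f₁ * pderiv i f₂ ∉ P)
    {a b : MvPolynomial σ k} (hab : a * b ∈ Ideal.span {f₁, f₂}) :
    ∃ s ∉ P, s * a ∈ Ideal.span {f₁, f₂} ∨ s * b ∈ Ideal.span {f₁, f₂} := by
  let α := algebraMap (MvPolynomial σ k) S
  have hm : maximalIdeal S = P.map α := (IsLocalization.AtPrime.map_eq_maximalIdeal P S).symm
  have hα₁ : α f₁ ∈ maximalIdeal S := hm ▸ Ideal.mem_map_of_mem _ h₁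
  have hα₂ : α f₂ ∈ maximalIdeal S := hm ▸ Ideal.mem_map_of_mem _ h₂
  have hm2 {x : MvPolynomial σ k} (hx : α x ∈ maximalIdeal S ^ 2) : ∃ s ∉ P, s * x ∈ P ^ 2 := by
    rw [hm, ← Ideal.map_pow] at hx
    obtain ⟨s, hs, h⟩ := (IsLocalization.algebraMap_mem_map_algebraMap_iff P.primeCompl S _ _).mp hx
    exact ⟨s, hs, h⟩
  have hα₁2 : α f₁ ∉ maximalIdeal S ^ 2 := fun h ↦ by
    obtain ⟨s, hs, h⟩ := hm2 h
    exact hs (mem_and_mem_of_add_mem_sq h₁ h₂ hij (v := 0) (by simpa using h)).1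
  let π := Ideal.Quotient.mk (Ideal.span {α f₁})
  have hπ : Function.Surjective π := Ideal.Quotient.mk_surjective
  have hreg : IsRegularLocalRing (S ⧸ Ideal.span {α f₁}) :=
    IsRegularLocalRing.quotient_span_singleton hα₁ hα₁2
  have hmπ : maximalIdeal (S ⧸ Ideal.span {α f₁}) = (maximalIdeal S).map π :=
    (IsLocalRing.map_maximalIdeal_of_surjective π hπ).symm
  have hπ₂ : π (α f₂) ∈ maximalIdeal (S ⧸ Ideal.span {α f₁}) := hmπ ▸ Ideal.mem_map_of_mem _ hα₂
  have hπ₂2 : π (α f₂) ∉ maximalIdeal (S ⧸ Ideal.span {α f₁}) ^ 2 := fun h ↦ by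
    rw [hmπ, ← Ideal.map_pow, Ideal.mem_map_iff_of_surjective π hπ] at h
    obtain ⟨z, hz, hzf⟩ := h
    obtain ⟨w, hw⟩ := Ideal.mem_span_singleton'.mp (Ideal.Quotient.eq.mp hzf)
    obtain ⟨⟨w', s⟩, hws⟩ := IsLocalization.surj P.primeCompl w
    have hmem : α (s * f₂ + w' * f₁) ∈ maximalIdeal S ^ 2 := by
      convert Ideal.mul_mem_left _ (α s) hz using 1
      simp only [map_add, map_mul]
      change w * α s = α w' at hws
      rw [← hws]
      linear_combination α s * hw
    obtain ⟨t, ht, h⟩ := hm2 hmem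
    have := (mem_and_mem_of_add_mem_sq h₁ h₂ hij (u := t * w') (v := t * s)
      (by convert h using 1; ring)).2
    exact (‹P.IsPrime›.mem_or_mem this).elim ht s.2
  have hreg₂ : IsRegularLocalRing ((S ⧸ Ideal.span {α f₁}) ⧸ Ideal.span {π (α f₂)}) :=
    IsRegularLocalRing.quotient_span_singleton hπ₂ hπ₂2
  have hprime : (Ideal.span {π (α f₂)}).IsPrime :=
    (Ideal.Quotient.isDomain_iff_prime _).mp IsRegularLocalRing.isDomain
  have hI : (Ideal.span {f₁, f₂}).map α = (Ideal.span {π (α f₂)}).comap π := by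
    have h : Ideal.span {π (α f₂)} = (Ideal.span {α f₂}).map π := by
      rw [Ideal.map_span, Set.image_singleton]
    rw [h, Ideal.comap_map_of_surjective π hπ,
      ← RingHom.ker_eq_comap_bot, Ideal.mk_ker, ← Ideal.span_union, Ideal.map_span, Set.image_pair,
      Set.union_comm]
    rfl
  have hIprime : ((Ideal.span {f₁, f₂}).map α).IsPrime := hI ▸ Ideal.comap_isPrime π _
  have hab' : α a * α b ∈ (Ideal.span {f₁, f₂}).map α := by
    rw [← map_mul]; exact Ideal.mem_map_of_mem _ hab
  rcases hIprime.mem_or_mem hab' with h | h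
  all_goals
    obtain ⟨s, hs, h⟩ := (IsLocalization.algebraMap_mem_map_algebraMap_iff P.primeCompl S _ _).mp h
  · exact ⟨s, hs, .inl h⟩
  · exact ⟨s, hs, .inr h⟩

lemma exists_notMem_mul_mem_span_pair [Finite σ] [P.IsPrime] (h₁ : f₁ ∈ P) (h₂ : f₂ ∈ P) {i j : σ}
    (hij : pderiv i f₁ * pderiv j f₂ - pderiv j f₁ * pderiv i f₂ ∉ P)
    {a b : MvPolynomial σ k} (hab : a * b ∈ Ideal.span {f₁, f₂}) :
    ∃ s ∉ P, s * a ∈ Ideal.span {f₁, f₂} ∨ s * b ∈ Ideal.span {f₁, f₂} :=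
  exists_notMem_mul_mem_span_pair_of_isRegularLocalRing (Localization.AtPrime P) h₁ h₂ hij hab

end Jacobian

section Nagata

open Polynomial MvPolynomial Ideal Nat RingHom List

variable {k : Type*} [Field k] {n : ℕ} (f : MvPolynomial (Fin (n + 1)) k)
variable (v w : Fin (n + 1) →₀ ℕ)

variable {f v} in
lemma forall_mem_ofFn_lt (vlt : ∀ i, v i < 2 + f.totalDegree) :
    ∀ l ∈ ofFn v, l < 2 + f.totalDegree := by
  grind

/-- The substitution fixing `X 0` and sending `X i` to `X i + c • X 0 ^ (up ^ i)` for `i ≠ 0`, where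
`up = 2 + f.totalDegree`. -/
noncomputable abbrev nagataHom (c : k) :
    MvPolynomial (Fin (n + 1)) k →ₐ[k] MvPolynomial (Fin (n + 1)) k :=
  aeval fun i ↦ if i = 0 then X 0 else X i + c • X 0 ^ (2 + f.totalDegree) ^ (i : ℕ)

lemma nagataHom_comp_nagataHom_neg (c : k) :
    (nagataHom f c).comp (nagataHom f (-c)) = AlgHom.id _ _ := by
  rw [comp_aeval, ← MvPolynomial.aeval_X_left]
  ext i v
  cases i using Fin.cases <;> simp

/-- The automorphism given by `nagataHom f 1`. -/
noncomputable abbrev nagataEquiv := AlgEquiv.ofAlgHom (nagataHom f 1) (nagataHom f (-1))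
  (nagataHom_comp_nagataHom_neg f 1) (by simpa using nagataHom_comp_nagataHom_neg f (-1))

lemma sum_pow_mul_ne (vlt : ∀ i, v i < 2 + f.totalDegree) (wlt : ∀ i, w i < 2 + f.totalDegree)
    (ne : v ≠ w) :
    ∑ x : Fin (n + 1), (2 + f.totalDegree) ^ (x : ℕ) * v x ≠
      ∑ x : Fin (n + 1), (2 + f.totalDegree) ^ (x : ℕ) * w x := by
  intro h
  refine ne <| Finsupp.ext <| congrFun <| ofFn_inj.mp ?_
  apply ofDigits_inj_of_len_eq (Nat.lt_add_right f.totalDegree one_lt_two)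
    (by simp) (forall_mem_ofFn_lt vlt) (forall_mem_ofFn_lt wlt)
  simpa only [ofDigits_eq_sum_mapIdx, mapIdx_eq_ofFn, get_ofFn, length_ofFn,
    Fin.val_cast, mul_comm, sum_ofFn] using! h

lemma degreeOf_zero_nagataEquiv {a : k} (ha : a ≠ 0) : ((nagataEquiv f) (monomial v a)).degreeOf 0 =
    ∑ i : Fin (n + 1), (2 + f.totalDegree) ^ i.1 * v i := by
  rw [← natDegree_finSuccEquiv, monomial_eq, Finsupp.prod_pow v fun a ↦ X a]
  simp only [Fin.prod_univ_succ, Fin.sum_univ_succ, map_mul, map_prod, map_pow,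
    AlgEquiv.ofAlgHom_apply, MvPolynomial.aeval_C, MvPolynomial.aeval_X, if_pos, Fin.succ_ne_zero,
    ite_false, one_smul, map_add, finSuccEquiv_X_zero, finSuccEquiv_X_succ, algebraMap_eq]
  have h (i : Fin n) :
      (Polynomial.C (X (R := k) i) +
        Polynomial.X ^ (2 + f.totalDegree) ^ (i.succ : ℕ)) ^ v i.succ ≠ 0 :=
    pow_ne_zero (v i.succ) (leadingCoeff_ne_zero.mp <| by simp [add_comm, leadingCoeff_X_pow_add_C])
  rw [natDegree_mul (by simp [ha]) (mul_ne_zero (by simp) (Finset.prod_ne_zero_iff.mpr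
    (fun i _ ↦ h i))), natDegree_mul (by simp) (Finset.prod_ne_zero_iff.mpr (fun i _ ↦ h i)),
    natDegree_prod _ _ (fun i _ ↦ h i), natDegree_finSuccEquiv, degreeOf_C]
  simpa only [natDegree_pow, zero_add, natDegree_X, mul_one, Fin.val_zero, pow_zero, one_mul,
    add_right_inj] using Finset.sum_congr rfl (fun i _ ↦ by
    rw [add_comm (Polynomial.C _), natDegree_X_pow_add_C, mul_comm])

lemma degreeOf_nagataEquiv_ne_of_ne (hv : v ∈ f.support) (hw : w ∈ f.support) (ne : v ≠ w) :
    (nagataEquiv f <| monomial v <| coeff v f).degreeOf 0 ≠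
    (nagataEquiv f <| monomial w <| coeff w f).degreeOf 0 := by
  rw [degreeOf_zero_nagataEquiv _ _ <| mem_support_iff.mp hv,
    degreeOf_zero_nagataEquiv _ _ <| mem_support_iff.mp hw]
  refine sum_pow_mul_ne f v w (fun i ↦ ?_) (fun i ↦ ?_) ne <;>
  exact lt_of_le_of_lt ((monomial_le_degreeOf i ‹_›).trans (degreeOf_le_totalDegree f i))
    (by lia)

lemma leadingCoeff_finSuccEquiv_nagataEquiv_monomial :
    (finSuccEquiv k n ((nagataEquiv f) ((monomial v) (coeff v f)))).leadingCoeff =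
    algebraMap k _ (coeff v f) := by
  rw [monomial_eq, Finsupp.prod_fintype]
  · simp only [map_mul, map_prod, leadingCoeff_mul, leadingCoeff_prod]
    rw [AlgEquiv.ofAlgHom_apply, algHom_C, algebraMap_eq, finSuccEquiv_apply,
      eval₂Hom_C, coe_comp]
    simp only [AlgEquiv.ofAlgHom_apply, Function.comp_apply, leadingCoeff_C, map_pow,
      leadingCoeff_pow, algebraMap_eq]
    have : ∀ j, ((finSuccEquiv k n) ((nagataHom f) 1 (X j))).leadingCoeff = 1 := fun j ↦ by
      by_cases h : j = 0
      · simp [h, finSuccEquiv_apply]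
      · simp only [aeval_eq_bind₁, bind₁_X_right, if_neg h, one_smul, map_add, map_pow]
        obtain ⟨i, rfl⟩ := Fin.exists_succ_eq.mpr h
        simp [finSuccEquiv_X_succ, finSuccEquiv_X_zero, add_comm]
    simp only [this, one_pow, Finset.prod_const_one, mul_one]
  exact fun i ↦ pow_zero _

lemma isUnit_leadingCoeff_finSuccEquiv_nagataEquiv (fne : f ≠ 0) :
    IsUnit (finSuccEquiv k n (nagataEquiv f f)).leadingCoeff := by
  obtain ⟨v, vin, vs⟩ := Finset.exists_max_image f.support
    (fun v ↦ (nagataEquiv f ((monomial v) (coeff v f))).degreeOf 0) (support_nonempty.mpr fne)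
  set h := fun w ↦ (MvPolynomial.monomial w) (coeff w f)
  simp only [← natDegree_finSuccEquiv] at vs
  replace vs : ∀ x ∈ f.support \ {v}, (finSuccEquiv k n ((nagataEquiv f) (h x))).degree <
      (finSuccEquiv k n ((nagataEquiv f) (h v))).degree := by
    intro x hx
    obtain ⟨h1, h2⟩ := Finset.mem_sdiff.mp hx
    apply degree_lt_degree <| lt_of_le_of_ne (vs x h1) ?_
    simpa only [natDegree_finSuccEquiv]
      using degreeOf_nagataEquiv_ne_of_ne f _ _ h1 vin <| ne_of_not_mem_cons h2
  have coeff :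
      (finSuccEquiv k n ((nagataEquiv f) (h v + ∑ x ∈ f.support \ {v}, h x))).leadingCoeff =
      (finSuccEquiv k n ((nagataEquiv f) (h v))).leadingCoeff := by
    simp only [map_add, map_sum]
    rw [add_comm]
    apply leadingCoeff_add_of_degree_lt <| (lt_of_le_of_lt <| degree_sum_le _ _) ?_
    have h2 : h v ≠ 0 := by simpa [h] using mem_support_iff.mp vin
    replace h2 : (finSuccEquiv k n ((nagataEquiv f) (h v))) ≠ 0 := fun eq ↦ h2 <|
      by simpa only [map_eq_zero_iff _ (AlgEquiv.injective _)] using eq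
    exact (Finset.sup_lt_iff <| Ne.bot_lt (fun x ↦ h2 <| degree_eq_bot.mp x)).mpr vs
  nth_rw 2 [← f.support_sum_monomial_coeff]
  rw [Finset.sum_eq_add_sum_sdiff_singleton_of_mem vin h]
  rw [leadingCoeff_finSuccEquiv_nagataEquiv_monomial] at coeff
  simpa only [coeff, algebraMap_eq] using (mem_support_iff.mp vin).isUnit.map MvPolynomial.C

variable {f} in
lemma exists_algEquiv_isUnit_leadingCoeff (hf : f ≠ 0) :
    ∃ e : MvPolynomial (Fin (n + 1)) k ≃ₐ[k] (MvPolynomial (Fin n) k)[X],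
      IsUnit (e f).leadingCoeff :=
  ⟨(nagataEquiv f).trans (finSuccEquiv k n),
    isUnit_leadingCoeff_finSuccEquiv_nagataEquiv f hf⟩

end Nagata

section RegularPair

/-- `x, y` acts as a regular sequence modulo `d` (except that the quotient may vanish). -/
def IsRegPair {S : Type*} [CommRing S] (x y d : S) : Prop :=
  (∀ s, d ∣ x * s → d ∣ s) ∧ ∀ r s, d ∣ x * s - y * r → ∃ e, d ∣ r - x * e

variable {S : Type*} [CommRing S]

lemma IsRegPair.of_mul {x y f g : S} (hf : f ∈ nonZeroDivisors S) (hg : g ∈ nonZeroDivisors S)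
    (h : IsRegPair x y (f * g)) : IsRegPair x y f := by
  have cancel_right {a b : S} (h : a * g ∣ b * g) : a ∣ b := by
    obtain ⟨c, hc⟩ := h
    exact ⟨c, by rw [← mul_cancel_right_mem_nonZeroDivisors hg, hc]; ring⟩
  have cancel_left {a b : S} (h : f * a ∣ f * b) : a ∣ b := by
    obtain ⟨c, hc⟩ := h
    exact ⟨c, by rw [← mul_cancel_left_mem_nonZeroDivisors hf, hc]; ring⟩
  refine ⟨fun s hs ↦ cancel_right (h.1 _ ?_), fun r s hs ↦ ?_⟩
  · rw [← mul_assoc]; exact mul_dvd_mul_right hs g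
  · obtain ⟨e, c, hc⟩ := h.2 (r * g) (s * g) (by convert mul_dvd_mul_right hs g using 1; ring)
    have h1 : g ∣ x * e := ⟨r - f * c, by linear_combination -hc⟩
    obtain ⟨e', rfl⟩ : g ∣ e := cancel_left (h.1 _ (by
      convert mul_dvd_mul_left f h1 using 1; ring))
    refine ⟨e', cancel_right ⟨c, ?_⟩⟩
    linear_combination hc

lemma IsRegPair.map {T : Type*} [CommRing T] (e : S ≃+* T) {x y d : S} (h : IsRegPair x y d) :
    IsRegPair (e x) (e y) (e d) := by
  have key (a : S) (b : T) : e a ∣ b ↔ a ∣ e.symm b := by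
    rw [← map_dvd_iff e, e.apply_symm_apply]
  refine ⟨fun s hs ↦ ?_, fun r s hs ↦ ?_⟩
  · rw [key] at hs ⊢
    exact h.1 _ (by simpa using hs)
  · rw [key] at hs
    obtain ⟨c, hc⟩ := h.2 (e.symm r) (e.symm s) (by simpa using hs)
    exact ⟨e c, by rw [key]; simpa using hc⟩

lemma IsRegPair.congr {x y d d' : S} (hd : Associated d d') (h : IsRegPair x y d) :
    IsRegPair x y d' := by
  simpa only [IsRegPair, hd.dvd_iff_dvd_left] using h

lemma IsRegPair.of_basis {A : Type*} [CommRing A] [Algebra A S] {ι : Type*} [Finite ι]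
    (b : Module.Basis ι A S) {x y d : A} (h : IsRegPair x y d) :
    IsRegPair (algebraMap A S x) (algebraMap A S y) (algebraMap A S d) := by
  have key (s : S) : algebraMap A S d ∣ s ↔ ∀ i, d ∣ b.equivFun s i := by
    constructor
    · rintro ⟨c, rfl⟩ i
      rw [← Algebra.smul_def, map_smul]
      exact ⟨_, rfl⟩
    · intro hs
      choose c hc using hs
      refine ⟨b.equivFun.symm c, b.equivFun.injective ?_⟩
      rw [← Algebra.smul_def, map_smul, LinearEquiv.apply_symm_apply]
      exact funext hc
  refine ⟨fun s hs ↦ ?_, fun r s hs ↦ ?_⟩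
  · rw [key] at hs ⊢
    intro i
    specialize hs i
    rw [← Algebra.smul_def, map_smul] at hs
    exact h.1 _ hs
  · rw [key] at hs
    simp only [← Algebra.smul_def, map_sub, map_smul] at hs
    choose e he using fun i ↦ h.2 (b.equivFun r i) (b.equivFun s i) (hs i)
    refine ⟨b.equivFun.symm e, (key _).mpr fun i ↦ ?_⟩
    simpa only [← Algebra.smul_def, map_sub, map_smul, LinearEquiv.apply_symm_apply, Pi.sub_apply,
      Pi.smul_apply, smul_eq_mul] using he i

open Polynomial in
lemma isRegPair_C_C {B : Type*} [CommRing B] {x y : B} (hx : ∀ z, x * z = 0 → z = 0)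
    (hxy : ∀ z, x ∣ y * z → x ∣ z) {D : B[X]} (hD : D.Monic) :
    IsRegPair (Polynomial.C x) (Polynomial.C y) D := by
  refine ⟨fun s hs ↦ ?_, fun r s hs ↦ ?_⟩
  · rw [← modByMonic_eq_zero_iff_dvd hD] at hs ⊢
    rw [← Polynomial.smul_eq_C_mul, smul_modByMonic] at hs
    ext i
    exact hx _ (by simpa using congrArg (Polynomial.coeff · i) hs)
  · rw [← modByMonic_eq_zero_iff_dvd hD, sub_modByMonic, ← Polynomial.smul_eq_C_mul,
      ← Polynomial.smul_eq_C_mul,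
      smul_modByMonic, smul_modByMonic, sub_eq_zero] at hs
    obtain ⟨e, he⟩ := (Polynomial.C_dvd_iff_dvd_coeff x (r %ₘ D)).mpr fun i ↦ hxy _
      ⟨_, by simpa using (congrArg (Polynomial.coeff · i) hs).symm⟩
    exact ⟨e, r /ₘ D, by linear_combination he - modByMonic_add_div r D⟩

end RegularPair

section Integral

open Polynomial

lemma isIntegral_comp_C_of_monic {A T : Type*} [CommRing A] [CommRing T] {θ : A[X] →+* T}
    (hθ : Function.Surjective θ) {p : A[X]} (hp : p.Monic) (h : θ p = 0) :
    (θ.comp Polynomial.C).IsIntegral := by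
  have hX : (θ.comp Polynomial.C).IsIntegralElem (θ Polynomial.X) := by
    refine ⟨p, hp, ?_⟩
    rw [← Polynomial.hom_eval₂, Polynomial.eval₂_C_X, h]
  have hC (a : A) : (θ.comp Polynomial.C).IsIntegralElem (θ (Polynomial.C a)) :=
    RingHom.isIntegralElem_map (θ.comp Polynomial.C) (x := a)
  intro t
  obtain ⟨q, rfl⟩ := hθ t
  induction q using Polynomial.induction_on with
  | C a => exact hC a
  | add p q hp hq => rw [map_add]; exact hp.add _ hq
  | monomial n a h => rw [pow_succ, ← mul_assoc, map_mul]; exact h.mul _ hX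

lemma exists_monic_associated {A : Type*} [CommRing A] {p : A[X]} (hp : IsUnit p.leadingCoeff) :
    ∃ q : A[X], q.Monic ∧ Associated p q :=
  ⟨_, monic_of_isUnit_leadingCoeff_inv_smul hp, hp.unit⁻¹.map Polynomial.C.toMonoidHom, by
    simp [Units.smul_def, Polynomial.smul_eq_C_mul, mul_comm]⟩

variable {A : Type*} [CommRing A] {f g : A[X]}

lemma mk_mem_nonZeroDivisors_of_isRelPrime [DecompositionMonoid A[X]] (h : IsRelPrime f g) :
    AdjoinRoot.mk f g ∈ nonZeroDivisors (AdjoinRoot f) := by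
  rw [mem_nonZeroDivisors_iff_right]
  intro z hz
  obtain ⟨q, rfl⟩ := AdjoinRoot.mk_surjective z
  rw [← map_mul, AdjoinRoot.mk_eq_zero, mul_comm] at hz
  exact AdjoinRoot.mk_eq_zero.mpr (h.dvd_of_dvd_mul_left hz)

lemma exists_ne_zero_forall_isRegPair [IsDomain A] [UniqueFactorizationMonoid A] (hf : f.Monic)
    (h : IsRelPrime f g) :
    ∃ D : A, D ≠ 0 ∧ AdjoinRoot.mk f g ∣ AdjoinRoot.of f D ∧ ∀ x y, IsRegPair x y D →
      IsRegPair (AdjoinRoot.of f x) (AdjoinRoot.of f y) (AdjoinRoot.mk f g) := by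
  have hg := mk_mem_nonZeroDivisors_of_isRelPrime h
  have := hf.finite_adjoinRoot
  have := hf.free_adjoinRoot
  obtain ⟨D, hD, hgD⟩ := (Algebra.IsIntegral.isIntegral (R := A)
    (AdjoinRoot.mk f g)).isAlgebraic.exists_nonzero_dvd hg
  refine ⟨D, hD, hgD, fun x y hxy ↦ ?_⟩
  obtain ⟨c, hc⟩ := hgD
  have h1 := hxy.of_basis (AdjoinRoot.powerBasis' hf).basis
  rw [hc] at h1
  refine h1.of_mul hg ?_
  rw [mem_nonZeroDivisors_iff_right]
  intro z hz
  have h2 : D • z = 0 := by rw [Algebra.smul_def, hc, mul_assoc, mul_comm c, hz, mul_zero]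
  exact (smul_eq_zero.mp h2).resolve_left hD

end Integral

section NoetherNormalization

variable {k : Type*} [Field k] {m : ℕ} {f₁ f₂ : MvPolynomial (Fin (m + 2)) k}

lemma exists_isIntegral_of_isRelPrime (hf : IsRelPrime f₁ f₂) (hf₁ : f₁ ≠ 0) :
    ∃ φ : MvPolynomial (Fin m) k →+* MvPolynomial (Fin (m + 2)) k,
      ((Ideal.Quotient.mk (Ideal.span {f₁, f₂})).comp φ).IsIntegral ∧
      ∀ x y, x ≠ 0 → IsRelPrime x y →
        (∀ r, φ x * r ∈ Ideal.span {f₁, f₂} → r ∈ Ideal.span {f₁, f₂}) ∧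
        (∀ r s, φ x * s - φ y * r ∈ Ideal.span {f₁, f₂} →
          ∃ e, r - φ x * e ∈ Ideal.span {f₁, f₂}) := by
  obtain ⟨e₁, he₁⟩ := exists_algEquiv_isUnit_leadingCoeff hf₁
  obtain ⟨f, hfm, hff₁⟩ := exists_monic_associated he₁
  have hfg : IsRelPrime f (e₁ f₂) := by
    intro d hd₁ hd₂
    have h₁ : e₁.symm d ∣ f₁ := by
      rw [← map_dvd_iff e₁]; simpa using hd₁.trans hff₁.dvd'
    have h₂ : e₁.symm d ∣ f₂ := by
      rw [← map_dvd_iff e₁]; simpa using hd₂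
    simpa using (hf h₁ h₂)
  obtain ⟨D, hD, hgD, hreg⟩ := exists_ne_zero_forall_isRegPair hfm hfg
  obtain ⟨e₂, he₂⟩ := exists_algEquiv_isUnit_leadingCoeff hD
  obtain ⟨D', hDm, hDD'⟩ := exists_monic_associated he₂
  have key (r) : r ∈ Ideal.span {f₁, f₂} ↔ AdjoinRoot.mk f (e₁ f₂) ∣ AdjoinRoot.mk f (e₁ r) := by
    rw [Ideal.mem_span_pair]
    constructor
    · rintro ⟨a, b, rfl⟩
      have : AdjoinRoot.mk f (e₁ f₁) = 0 := AdjoinRoot.mk_eq_zero.mpr hff₁.dvd'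
      simp [this]
    · rintro ⟨c, hc⟩
      obtain ⟨q, rfl⟩ := AdjoinRoot.mk_surjective c
      rw [← map_mul, AdjoinRoot.mk_eq_mk] at hc
      obtain ⟨t, ht⟩ := hff₁.dvd.trans hc
      refine ⟨e₁.symm t, e₁.symm q, e₁.injective ?_⟩
      simp only [map_add, map_mul, AlgEquiv.apply_symm_apply]
      linear_combination -ht
  let ι : MvPolynomial (Fin (m + 1)) k →+* MvPolynomial (Fin (m + 2)) k :=
    (e₁.symm : _ →+* _).comp Polynomial.C
  let κ : MvPolynomial (Fin m) k →+* MvPolynomial (Fin (m + 1)) k :=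
    (e₂.symm : _ →+* _).comp Polynomial.C
  have hι (x) : e₁ (ι x) = Polynomial.C x := e₁.apply_symm_apply _
  refine ⟨ι.comp κ, ?_, fun x y hx hxy ↦ ?_⟩
  · have h₁ : ((Ideal.Quotient.mk (Ideal.span {f₁, f₂})).comp ι).IsIntegral := by
      refine isIntegral_comp_C_of_monic
        (θ := (Ideal.Quotient.mk (Ideal.span {f₁, f₂})).comp (e₁.symm : _ →+* _))
        (Ideal.Quotient.mk_surjective.comp e₁.symm.surjective) hfm ?_
      refine Ideal.Quotient.eq_zero_iff_mem.mpr ((key _).mpr ?_)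
      simp
    have hιD : ∀ a ∈ Ideal.span {D}, (Ideal.Quotient.mk (Ideal.span {f₁, f₂})).comp ι a = 0 := by
      intro a ha
      obtain ⟨c, rfl⟩ := Ideal.mem_span_singleton.mp ha
      refine Ideal.Quotient.eq_zero_iff_mem.mpr ((key _).mpr ?_)
      rw [hι, map_mul, map_mul]
      exact hgD.mul_right _
    have h₂ : (Ideal.Quotient.lift _ _ hιD).IsIntegral := by
      refine RingHom.IsIntegral.tower_top (Ideal.Quotient.mk (Ideal.span {D})) _ ?_
      exact h₁
    have h₃ : ((Ideal.Quotient.mk (Ideal.span {D})).comp κ).IsIntegral := by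
      refine isIntegral_comp_C_of_monic
        (θ := (Ideal.Quotient.mk (Ideal.span {D})).comp (e₂.symm : _ →+* _))
        (Ideal.Quotient.mk_surjective.comp e₂.symm.surjective) hDm ?_
      refine Ideal.Quotient.eq_zero_iff_mem.mpr (Ideal.mem_span_singleton.mpr ?_)
      rw [← map_dvd_iff e₂]
      simpa using hDD'.dvd
    exact h₃.trans _ _ h₂
  · have h₁ := ((isRegPair_C_C (fun z hz ↦ (mul_eq_zero.mp hz).resolve_left hx)
      (fun z hz ↦ hxy.dvd_of_dvd_mul_left hz) hDm).congr hDD'.symm).map e₂.symm.toRingEquiv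
    have h₂ : IsRegPair (κ x) (κ y) D := by
      rwa [← e₂.symm_apply_apply D]
    have h₃ := hreg _ _ h₂
    have hικ (z) : e₁ ((ι.comp κ) z) = Polynomial.C (κ z) := hι _
    refine ⟨fun r hr ↦ ?_, fun r s hs ↦ ?_⟩
    · rw [key, map_mul, hικ, map_mul] at hr
      exact (key _).mpr (h₃.1 _ hr)
    · rw [key, map_sub, map_mul, map_mul, hικ x, hικ y, map_sub,
        map_mul, map_mul] at hs
      obtain ⟨e, he⟩ := h₃.2 _ _ hs
      obtain ⟨e, rfl⟩ := AdjoinRoot.mk_surjective e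
      refine ⟨e₁.symm e, ?_⟩
      rw [key, map_sub, map_mul, hικ, map_sub, map_mul]
      simpa using he

end NoetherNormalization

section Idempotent

variable {σ k : Type*} [Field k]

lemma mem_idealOfVars_iff_constantCoeff {f : MvPolynomial σ k} :
    f ∈ idealOfVars σ k ↔ constantCoeff f = 0 := by
  rw [← pow_one (idealOfVars σ k), mem_pow_idealOfVars_iff', constantCoeff_eq]
  simp only [Nat.lt_one_iff, Finsupp.degree_eq_zero_iff, forall_eq]

attribute [local instance] MvPolynomial.gradedAlgebra

lemma mem_of_isHomogeneous_of_sub_sq_mem {I : Ideal (MvPolynomial σ k)}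
    (hI : I.IsHomogeneous (homogeneousSubmodule σ k)) {e : MvPolynomial σ k}
    (he : constantCoeff e = 0) (h : e * (1 - e) ∈ I) : e ∈ I := by
  rw [mem_iff_homogeneousComponent_mem hI]
  intro i
  have hpow (N : ℕ) : e - e ^ (N + 1) ∈ I := by
    induction N with
    | zero => simp
    | succ N ih =>
      convert add_mem ih (I.mul_mem_left (e ^ N) h) using 1
      ring
  have h0 : homogeneousComponent i (e ^ (i + 1)) = 0 := by
    apply homogeneousComponent_eq_zero'
    intro d hd
    have := (mem_pow_idealOfVars_iff (i + 1) _).mp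
      (Ideal.pow_mem_pow (mem_idealOfVars_iff_constantCoeff.mpr he) (i + 1)) d hd
    omega
  simpa [h0] using homogeneousComponent_mem_of_mem hI (hpow i) i

lemma mem_or_one_sub_mem_of_isHomogeneous {I : Ideal (MvPolynomial σ k)}
    (hI : I.IsHomogeneous (homogeneousSubmodule σ k)) (hI' : ∀ a ∈ I, constantCoeff a = 0)
    {e : MvPolynomial σ k} (h : e * (1 - e) ∈ I) : e ∈ I ∨ 1 - e ∈ I := by
  have h0 := hI' _ h
  rw [map_mul, mul_eq_zero] at h0
  exact h0.imp (fun h1 ↦ mem_of_isHomogeneous_of_sub_sq_mem hI h1 h)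
    fun h1 ↦ mem_of_isHomogeneous_of_sub_sq_mem hI h1 (by convert h using 1; ring)

lemma isHomogeneous_span_pair {f₁ f₂ : MvPolynomial σ k} {d₁ d₂ : ℕ}
    (hf₁ : f₁.IsHomogeneous d₁) (hf₂ : f₂.IsHomogeneous d₂) :
    (Ideal.span {f₁, f₂}).IsHomogeneous (homogeneousSubmodule σ k) := by
  refine Ideal.homogeneous_span _ _ ?_
  rintro x (rfl | rfl)
  exacts [⟨_, hf₁⟩, ⟨_, hf₂⟩]

lemma MvPolynomial.IsHomogeneous.constantCoeff_eq_zero {f : MvPolynomial σ k} {d : ℕ}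
    (hf : f.IsHomogeneous d) (hd : 0 < d) : constantCoeff f = 0 :=
  hf.coeff_eq_zero (by simpa using hd.ne)

end Idempotent

section Colon

variable {R : Type*} [CommRing R] {I : Ideal R}

lemma exists_notMem_colon_of_forall [IsNoetherianRing R] {P : Ideal R} [P.IsPrime] {b : R}
    (h : ∀ x, x * b ∈ I → ∃ s ∉ P, s * x ∈ I ∨ s * b ∈ I) :
    ¬ (I.colon {b} ⊔ I.colon (I.colon {b} : Set R) ≤ P) := by
  classical
  intro hP
  have hb {s : R} (hs : s ∉ P) : s * b ∉ I := fun h1 ↦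
    hs (hP (Ideal.mem_sup_left (by simpa [Submodule.mem_colon_singleton] using h1)))
  obtain ⟨G, hG⟩ := (I.colon {b}).fg_of_isNoetherianRing
  have (g : R) : ∃ s ∉ P, g ∈ G → s * g ∈ I := by
    by_cases hg : g ∈ G
    · have h1 : g ∈ I.colon {b} := hG ▸ Submodule.subset_span hg
      obtain ⟨s, hs, h2⟩ := h g (by simpa [Submodule.mem_colon_singleton] using h1)
      exact ⟨s, hs, fun _ ↦ h2.resolve_right (hb hs)⟩
    · exact ⟨1, (Ideal.ne_top_iff_one _).mp ‹P.IsPrime›.ne_top, fun h ↦ absurd h hg⟩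
  choose s hs hsG using this
  have hprod : ∏ g ∈ G, s g ∉ P := by
    rw [Ideal.IsPrime.prod_mem_iff]
    rintro ⟨g, -, hg⟩
    exact hs g hg
  refine hprod (hP (Ideal.mem_sup_right (Submodule.mem_colon.mpr fun u hu ↦ ?_)))
  have hle : Ideal.span (G : Set R) ≤ I.colon {∏ g ∈ G, s g} := by
    rw [Ideal.span_le]
    intro g hg
    rw [SetLike.mem_coe, Submodule.mem_colon_singleton, smul_eq_mul, ← Finset.prod_erase_mul G s hg]
    convert I.mul_mem_left (∏ x ∈ G.erase g, s x) (hsG g hg) using 1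
    ring
  rw [hG] at hle
  have := hle hu
  rwa [Submodule.mem_colon_singleton, smul_eq_mul, mul_comm] at this

end Colon

section Height

variable {B R : Type*} [CommRing B] [CommRing R] [IsNoetherianRing R] {φ : B →+* R} {f₁ f₂ : R}

lemma not_comap_le_of_mem_minimalPrimes_span_singleton
    (hφ : ((Ideal.Quotient.mk (Ideal.span {f₁, f₂})).comp φ).IsIntegral) {𝔞 : Ideal R}
    (hI : Ideal.span {f₁, f₂} ≤ 𝔞) (h𝔞 : ∀ P : Ideal R, P.IsPrime → 𝔞 ≤ P → 3 < P.height)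
    {c : B} {q : Ideal B} (hq : q ∈ (Ideal.span {c}).minimalPrimes) : ¬ 𝔞.comap φ ≤ q := by
  intro hle
  let π := Ideal.Quotient.mk (Ideal.span {f₁, f₂})
  have hπ : Function.Surjective π := Ideal.Quotient.mk_surjective
  have hker : RingHom.ker π = Ideal.span {f₁, f₂} := Ideal.mk_ker
  let : Algebra B (R ⧸ Ideal.span {f₁, f₂}) := (π.comp φ).toAlgebra
  have : Algebra.IsIntegral B (R ⧸ Ideal.span {f₁, f₂}) := ⟨hφ⟩
  have hqp := hq.isPrime
  have hcm (Q : Ideal R) (hQ : Ideal.span {f₁, f₂} ≤ Q) : (Q.map π).comap π = Q := by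
    rw [Ideal.comap_map_of_surjective π hπ, ← RingHom.ker_eq_comap_bot, hker]
    exact sup_eq_left.mpr hQ
  obtain ⟨Q, hQ𝔞, hQp, hQq⟩ := Ideal.exists_ideal_over_prime_of_isIntegral q (𝔞.map π) (by
    change (𝔞.map π).comap (π.comp φ) ≤ q
    rwa [← Ideal.comap_comap, hcm _ hI])
  change Q.comap (π.comp φ) = q at hQq
  have h1 : 𝔞 ≤ Q.comap π := Ideal.map_le_iff_le_comap.mp hQ𝔞
  have hmin : Q.comap π ∈ (Ideal.span {f₁, f₂, φ c}).minimalPrimes := by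
    refine ⟨⟨inferInstance, ?_⟩, fun P ⟨hP, hP'⟩ hPQ ↦ ?_⟩
    · rw [Ideal.span_le]
      rintro x (rfl | rfl | rfl)
      · exact h1 (hI (Ideal.subset_span (by simp)))
      · exact h1 (hI (Ideal.subset_span (by simp)))
      · change c ∈ Q.comap (π.comp φ)
        rw [hQq]
        exact hq.1.2 (Ideal.mem_span_singleton_self c)
    · have hIP : Ideal.span {f₁, f₂} ≤ P := (Ideal.span_mono (by grind)).trans hP'
      have hPp : (P.map π).IsPrime := Ideal.map_isPrime_of_surjective hπ (hker.trans_le hIP)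
      have hle' : P.map π ≤ Q := Ideal.map_le_iff_le_comap.mpr hPQ
      have hqP : q ≤ (P.map π).comap (π.comp φ) := by
        refine hq.2 ⟨inferInstance, ?_⟩ ?_
        · rw [Ideal.span_singleton_le_iff_mem, ← Ideal.comap_comap, hcm _ hIP]
          exact hP' (Ideal.subset_span (by simp))
        · rw [← hQq]
          exact Ideal.comap_mono hle'
      by_contra hne
      obtain ⟨x, hx, hxP⟩ := SetLike.not_le_iff_exists.mp hne
      have := Ideal.comap_lt_comap_of_integral_mem_sdiff (R := B) hle' (x := π x)
        ⟨hx, fun h ↦ hxP (by rwa [← hcm _ hIP])⟩ (Algebra.IsIntegral.isIntegral _)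
      exact this.not_ge (hQq.trans_le hqP)
  have h2 := h𝔞 _ inferInstance h1
  have h3 : Set.ncard {f₁, f₂, φ c} ≤ 3 :=
    (Set.ncard_insert_le _ _).trans (Nat.succ_le_succ
      ((Set.ncard_insert_le _ _).trans (by rw [Set.ncard_singleton])))
  exact not_le.mpr h2 ((Ideal.height_le_card_of_mem_minimalPrimes_span (Set.toFinite _) hmin).trans
    (by exact_mod_cast h3))

lemma exists_isRelPrime_mem_of_forall [IsDomain B] [UniqueFactorizationMonoid B] {𝔟 : Ideal B}
    (h : ∀ c, ∀ q ∈ (Ideal.span {c}).minimalPrimes, ¬ 𝔟 ≤ q) :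
    ∃ x ∈ 𝔟, ∃ y ∈ 𝔟, x ≠ 0 ∧ IsRelPrime x y := by
  classical
  have hmin {q : Ideal B} (c : B) (hq : q.IsPrime) (hc : q = Ideal.span {c}) : ¬ 𝔟 ≤ q :=
    h c q (by
      rw [← hc, Ideal.minimalPrimes_eq_subsingleton_self]
      rfl)
  obtain ⟨x, hx, hx0⟩ : ∃ x ∈ 𝔟, x ≠ 0 := by
    by_contra! h0
    exact hmin 0 Ideal.isPrime_bot (by simp) fun x hx ↦ h0 x hx
  obtain ⟨y, hy, hyx⟩ : ∃ y ∈ 𝔟, ∀ p ∈ UniqueFactorizationMonoid.factors x, ¬ p ∣ y := by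
    by_contra! h0
    have hsub : (𝔟 : Set B) ⊆ ⋃ p ∈ ((UniqueFactorizationMonoid.factors x).toFinset : Set B),
        (Ideal.span {p} : Set B) := by
      intro y hy
      obtain ⟨p, hp, hpy⟩ := h0 y hy
      simp only [Set.mem_iUnion]
      exact ⟨p, by simpa using hp, Ideal.mem_span_singleton.mpr hpy⟩
    have hprime (p) (hp : p ∈ (UniqueFactorizationMonoid.factors x).toFinset) :
        (Ideal.span {p}).IsPrime := by
      have := UniqueFactorizationMonoid.prime_of_factor p (by simpa using hp)
      exact (Ideal.span_singleton_prime this.ne_zero).mpr this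
    obtain ⟨p, hp, hle⟩ := (Ideal.subset_union_prime (f := fun p ↦ Ideal.span {p}) 0 0
      (fun p hp _ _ ↦ hprime p hp)).mp hsub
    exact hmin p (hprime p hp) rfl hle
  refine ⟨x, hx, y, hy, hx0, ?_⟩
  refine (UniqueFactorizationMonoid.isRelPrime_iff_no_prime_factors hx0).mpr fun d hdx hdy hd ↦ ?_
  obtain ⟨p, hp, hdp⟩ := UniqueFactorizationMonoid.exists_mem_factors_of_dvd hx0 hd.irreducible hdx
  exact hyx p hp (hdp.dvd'.trans hdy)

end Height

lemma lt_height_of_lt_idealHeight {R : Type*} [CommRing R] {J P : Ideal R} [hP : P.IsPrime]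
    {c : ℕ∞} (hJ : c < idealHeight J) (hJP : J ≤ P) : c < P.height := by
  have := PrimeSpectrum.height_eq_orderHeight (⟨P, hP⟩ : PrimeSpectrum R)
  rw [this]
  exact hJ.trans_le (iInf₂_le (⟨P, hP⟩ : PrimeSpectrum R) hJP)

section SingularLocus

variable {k : Type*} [Field k] {n : ℕ} {f₁ f₂ : MvPolynomial (Fin n) k}

lemma isRelPrime_of_lt_idealHeight
    (hJ : 4 < idealHeight (Ideal.span
      ({f₁, f₂} ∪ {m : MvPolynomial (Fin n) k | ∃ i j : Fin n,
        m = pderiv i f₁ * pderiv j f₂ - pderiv j f₁ * pderiv i f₂}))) :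
    IsRelPrime f₁ f₂ := by
  rintro c ⟨a, rfl⟩ ⟨b, rfl⟩
  by_contra hc
  obtain ⟨q, hq⟩ := Ideal.nonempty_minimalPrimes
    (I := Ideal.span {c}) (by simpa [Ideal.span_singleton_eq_top] using hc)
  have hqp := hq.isPrime
  have hcq : c ∈ q := hq.1.2 (Ideal.mem_span_singleton_self c)
  have hle := Ideal.height_le_one_of_isPrincipal_of_mem_minimalPrimes (Ideal.span {c}) q hq
  have hlt : 4 < q.height := by
    refine lt_height_of_lt_idealHeight hJ (Ideal.span_le.mpr ?_)
    rintro x ((rfl | rfl) | ⟨i, j, rfl⟩)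
    · exact q.mul_mem_right _ hcq
    · exact q.mul_mem_right _ hcq
    · rw [SetLike.mem_coe]
      convert q.mul_mem_right (c * (pderiv i a * pderiv j b - pderiv j a * pderiv i b) +
        b * (pderiv i a * pderiv j c - pderiv j a * pderiv i c) +
        a * (pderiv i c * pderiv j b - pderiv j c * pderiv i b)) hcq using 1
      simp only [Derivation.leibniz, smul_eq_mul]
      ring
  exact absurd (hlt.trans_le hle) (by decide)

lemma X_zero_dvd_of_constantCoeff_eq_zero {f : MvPolynomial (Fin 1) k}
    (hf : constantCoeff f = 0) : X 0 ∣ f := by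
  have h := mem_idealOfVars_iff_constantCoeff.mpr hf
  rwa [idealOfVars, Set.range_unique, Ideal.mem_span_singleton] at h

lemma exists_eq_add_two_of_isRelPrime (h : IsRelPrime f₁ f₂) (h₁ : constantCoeff f₁ = 0)
    (h₂ : constantCoeff f₂ = 0) (hn : 1 ≤ n) : ∃ m, n = m + 2 := by
  obtain _ | _ | m := n
  · omega
  · have := (h (X_zero_dvd_of_constantCoeff_eq_zero h₁)
      (X_zero_dvd_of_constantCoeff_eq_zero h₂)).map (constantCoeff (R := k))
    simp at this
  · exact ⟨m, rfl⟩

end SingularLocus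

section Connectedness

/-- An algebraic form of Hartshorne's connectedness argument: a pair `φ x`, `φ y` which is
regular modulo `I` and lies in `I.colon {b} ⊔ I.colon (I.colon {b})` yields an idempotent
modulo `I`. -/
lemma mem_or_mem_of_isRegPair_mem {R : Type*} [CommRing R] {I : Ideal R} {a b x y : R}
    (hab : a * b ∈ I) (hidem : ∀ e, e * (1 - e) ∈ I → e ∈ I ∨ 1 - e ∈ I)
    (hx : x ∈ I.colon {b} ⊔ I.colon (I.colon {b} : Set R))
    (hy : y ∈ I.colon {b} ⊔ I.colon (I.colon {b} : Set R))
    (hreg : ∀ r, x * r ∈ I → r ∈ I)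
    (hreg' : ∀ r s, x * s - y * r ∈ I → ∃ e, r - x * e ∈ I) : a ∈ I ∨ b ∈ I := by
  obtain ⟨x₁, hx₁, x₂, hx₂, rfl⟩ := Submodule.mem_sup.mp hx
  obtain ⟨y₁, hy₁, y₂, hy₂, rfl⟩ := Submodule.mem_sup.mp hy
  have hmul {u v : R} (hu : u ∈ I.colon {b}) (hv : v ∈ I.colon (I.colon {b} : Set R)) :
      v * u ∈ I := Submodule.mem_colon.mp hv u hu
  obtain ⟨e, he⟩ := hreg' x₁ y₁ (by
    convert sub_mem (hmul hy₁ hx₂) (hmul hx₁ hy₂) using 1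
    ring)
  have hb {u : R} (hu : u ∈ I.colon {b}) : u * b ∈ I := by
    simpa [Submodule.mem_colon_singleton] using hu
  have ha : a ∈ I.colon {b} := by simpa [Submodule.mem_colon_singleton] using hab
  have hee : e * (1 - e) ∈ I := by
    refine hreg _ (hreg _ ?_)
    have h1 := hmul hx₁ hx₂
    convert sub_mem h1 (I.mul_mem_left (x₂ - (x₁ + x₂) * e) he) using 1
    ring
  rcases hidem e hee with h | h
  · left
    refine hreg _ ?_
    have hx₁I : x₁ ∈ I := by
      convert add_mem he (I.mul_mem_left (x₁ + x₂) h) using 1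
      ring
    convert add_mem (I.mul_mem_left a hx₁I) (hmul ha hx₂) using 1
    ring
  · right
    refine hreg _ ?_
    convert add_mem (sub_mem (hb hx₁) (I.mul_mem_left b he))
      (I.mul_mem_left ((x₁ + x₂) * b) h) using 1
    ring

end Connectedness

/-- Let `f₁, f₂` be homogeneous polynomials of positive degree over an
algebraically closed field, and let `J` be the ideal generated by `f₁, f₂` together with the
`2×2` minors of their Jacobian matrix.  If the height of `J` is greater than `4`, then the
ideal `(f₁, f₂)` is prime. -/
theorem stmt_2 {k : Type*} [Field k] [IsAlgClosed k] (n : ℕ) (hn : 1 ≤ n)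
    (f₁ f₂ : MvPolynomial (Fin n) k) (d₁ d₂ : ℕ) (hd₁ : 0 < d₁) (hd₂ : 0 < d₂)
    (hf₁ : f₁.IsHomogeneous d₁) (hf₂ : f₂.IsHomogeneous d₂)
    (hJ : 4 < idealHeight (Ideal.span
      ({f₁, f₂} ∪ {m : MvPolynomial (Fin n) k | ∃ i j : Fin n,
        m = pderiv i f₁ * pderiv j f₂ - pderiv j f₁ * pderiv i f₂}))) :
    (Ideal.span {f₁, f₂}).IsPrime := by
  have hrel := isRelPrime_of_lt_idealHeight hJ
  have hc₁ := hf₁.constantCoeff_eq_zero hd₁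
  have hc₂ := hf₂.constantCoeff_eq_zero hd₂
  obtain ⟨m, rfl⟩ := exists_eq_add_two_of_isRelPrime hrel hc₁ hc₂ hn
  have hne : f₁ ≠ 0 := by
    rintro rfl
    have := (hrel (dvd_zero f₂) dvd_rfl).map (constantCoeff (R := k))
    simp [hc₂] at this
  have hI (a) (ha : a ∈ Ideal.span {f₁, f₂}) : constantCoeff a = 0 := by
    obtain ⟨u, v, rfl⟩ := Ideal.mem_span_pair.mp ha
    simp [hc₁, hc₂]
  have hIle {P : Ideal (MvPolynomial (Fin (m + 2)) k)} (h : Ideal.span {f₁, f₂} ≤ P) :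
      f₁ ∈ P ∧ f₂ ∈ P := ⟨h (Ideal.subset_span (by simp)), h (Ideal.subset_span (by simp))⟩
  obtain ⟨φ, hφ, hreg⟩ := exists_isIntegral_of_isRelPrime hrel hne
  refine ⟨fun h ↦ ?_, fun {a b} hab ↦ ?_⟩
  · simpa using hI 1 (h ▸ Submodule.mem_top)
  have hle : Ideal.span {f₁, f₂} ≤ (Ideal.span {f₁, f₂}).colon {b} ⊔
      (Ideal.span {f₁, f₂}).colon ((Ideal.span {f₁, f₂}).colon {b} : Set _) :=
    le_sup_of_le_left fun x hx ↦ Submodule.mem_colon_singleton.mpr (Ideal.mul_mem_right _ _ hx)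
  have hheight (P : Ideal (MvPolynomial (Fin (m + 2)) k)) (hP : P.IsPrime)
      (h : (Ideal.span {f₁, f₂}).colon {b} ⊔
        (Ideal.span {f₁, f₂}).colon ((Ideal.span {f₁, f₂}).colon {b} : Set _) ≤ P) :
      3 < P.height := by
    obtain ⟨h₁, h₂⟩ := hIle (hle.trans h)
    refine lt_trans (by decide) (lt_height_of_lt_idealHeight hJ (Ideal.span_le.mpr ?_))
    rintro x ((rfl | rfl) | ⟨i, j, rfl⟩)
    · exact h₁
    · exact h₂
    · by_contra hij
      exact exists_notMem_colon_of_forall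
        (fun x hx ↦ exists_notMem_mul_mem_span_pair h₁ h₂ hij hx) h
  obtain ⟨x, hx, y, hy, hx0, hxy⟩ := exists_isRelPrime_mem_of_forall fun c q hq ↦
    not_comap_le_of_mem_minimalPrimes_span_singleton hφ hle hheight hq
  obtain ⟨hreg₁, hreg₂⟩ := hreg x y hx0 hxy
  exact mem_or_mem_of_isRegPair_mem hab
    (fun e ↦ mem_or_one_sub_mem_of_isHomogeneous (isHomogeneous_span_pair hf₁ hf₂) hI)
    hx hy hreg₁ hreg₂
end

section
/- Let k be an algebraically closed field of characteristic different from 2, let n ≥ 1, and let f₁, f₂, f₃ be homogeneous polynomials of degree 2 in k[x₁,…,xₙ]. Suppose that for every triple (c₁,c₂,c₃) ∈ k³ with (c₁,c₂,c₃) ≠ (0,0,0), the combination c₁f₁ + c₂f₂ + c₃f₃ is nonzero and cannot be written in the form ℓ₁m₁ + ℓ₂m₂ for homogeneous polynomials ℓ₁, ℓ₂, m₁, m₂ of degree 1. Then f₁, f₂, f₃ is a regular sequence on k[x₁,…,xₙ]. -/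
open MvPolynomial

theorem Prime.exists_mul_of_pow_mul_eq {A : Type*} [CommRing A] [IsDomain A] {p : A}
    (hp : Prime p) {a : A} (N : ℕ) : ∀ {u v : A}, p ^ N * a = u * v →
      ∃ (i j : ℕ) (u' v' : A), u = p ^ i * u' ∧ v = p ^ j * v' ∧ a = u' * v' := by
  induction N with
  | zero => intro u v h; exact ⟨0, 0, u, v, by simp, by simp, by simpa using h⟩
  | succ N ih =>
    intro u v h
    have hd : p ∣ u * v := ⟨p ^ N * a, by rw [← h]; ring⟩
    rcases hp.dvd_or_dvd hd with ⟨w, rfl⟩ | ⟨w, rfl⟩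
    · have : p ^ N * a = w * v := mul_left_cancel₀ hp.ne_zero (by linear_combination h)
      obtain ⟨i, j, u', v', h1, h2, h3⟩ := ih this
      exact ⟨i + 1, j, u', v', by rw [h1]; ring, h2, h3⟩
    · have : p ^ N * a = u * w := mul_left_cancel₀ hp.ne_zero (by linear_combination h)
      obtain ⟨i, j, u', v', h1, h2, h3⟩ := ih this
      exact ⟨i, j + 1, u', v', h1, by rw [h2]; ring, h3⟩

theorem Prime.dvd_of_dvd_pow_mul {A : Type*} [CommRing A] [IsDomain A] {p a b : A}
    (hp : Prime p) (ha : ¬ p ∣ a) (N : ℕ) (h : a ∣ p ^ N * b) : a ∣ b := by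
  obtain ⟨d, hd⟩ := h
  obtain ⟨i, j, u, v, h1, h2, h3⟩ := hp.exists_mul_of_pow_mul_eq N hd
  rcases i with _ | i
  · exact ⟨v, by rw [h3, h1]; simp⟩
  · exact absurd ⟨p ^ i * u, by rw [h1]; ring⟩ ha

/-- Criterion of Nagata: if inverting a prime element of `A` turns `A` into a localization of a
factorial ring `B`, then irreducible elements of `A` are prime. -/
theorem Irreducible.prime_of_localization {A B : Type*} [CommRing A] [IsDomain A] [CommRing B]
    [IsDomain B] [UniqueFactorizationMonoid B] (φ : B →+* A) (hφ : Function.Injective φ) {y : B}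
    (hy : Prime y) (hyA : Prime (φ y)) (hfrac : ∀ a : A, ∃ (N : ℕ) (b : B), φ y ^ N * a = φ b)
    {a : A} (ha : Irreducible a) : Prime a := by
  by_cases hya : φ y ∣ a
  · exact (hyA.irreducible.associated_of_dvd ha hya).prime hyA
  obtain ⟨N, b, hb⟩ := hfrac a
  have hb0 : b ≠ 0 := by
    rintro rfl
    rw [map_zero] at hb
    exact mul_ne_zero (pow_ne_zero _ hyA.ne_zero) ha.ne_zero hb
  obtain ⟨M, F, hyF, rfl⟩ := WfDvdMonoid.max_power_factor hb0 hy.irreducible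
  obtain ⟨K, hK⟩ : ∃ K, φ y ^ K * a = φ F := by
    rcases le_or_gt M N with h | h
    · obtain ⟨K, rfl⟩ := Nat.exists_eq_add_of_le h
      refine ⟨K, mul_left_cancel₀ (pow_ne_zero M hyA.ne_zero) ?_⟩
      rw [map_mul, map_pow] at hb
      rw [← hb]; ring
    · obtain ⟨K, rfl⟩ := Nat.exists_eq_add_of_lt h
      refine absurd ⟨φ y ^ K * φ F, mul_left_cancel₀ (pow_ne_zero N hyA.ne_zero) ?_⟩ hya
      rw [map_mul, map_pow] at hb
      rw [hb]; ring
  have unit_of : ∀ (F₁ : B) (i : ℕ) (G : A), F₁ ∣ F → φ F₁ = φ y ^ i * G → IsUnit G →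
      IsUnit F₁ := by
    intro F₁ i G hF₁ h1 hG
    obtain ⟨G', hG'⟩ := hG.exists_right_inv
    obtain ⟨n, c, hc⟩ := hfrac G'
    have h2 : F₁ ∣ y ^ (i + n) := ⟨c, hφ <| by
      rw [map_mul, map_pow, h1, ← hc]
      linear_combination (- φ y ^ (i + n)) * hG'⟩
    obtain ⟨l, -, hl⟩ := (dvd_prime_pow hy _).1 h2
    rcases l with _ | l
    · exact (associated_one_iff_isUnit.1 (by simpa using hl))
    · exact absurd (((dvd_pow_self y l.succ_ne_zero).trans hl.symm.dvd).trans hF₁) hyF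
  have hFirr : Irreducible F := by
    refine ⟨fun hF => ?_, ?_⟩
    · have : IsUnit (φ y ^ K * a) := hK ▸ hF.map φ
      exact ha.not_isUnit (isUnit_of_mul_isUnit_right this)
    · rintro F₁ F₂ rfl
      rw [map_mul] at hK
      obtain ⟨i, j, u, v, h1, h2, h3⟩ := hyA.exists_mul_of_pow_mul_eq K hK
      rcases ha.isUnit_or_isUnit h3 with h | h
      · exact Or.inl (unit_of _ _ _ (dvd_mul_right _ _) h1 h)
      · exact Or.inr (unit_of _ _ _ (dvd_mul_left _ _) h2 h)
  have hF : Prime F := UniqueFactorizationMonoid.irreducible_iff_prime.1 hFirr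
  have hFy : ∀ n, ¬ F ∣ y ^ n := fun n h =>
    hyF (hF.irreducible.associated_of_dvd hy.irreducible (hF.dvd_of_dvd_pow h)).symm.dvd
  have key : ∀ (b : A) (b' : B) (n : ℕ), φ y ^ n * b = φ b' → F ∣ b' → a ∣ b := by
    rintro b _ n h ⟨e, rfl⟩
    refine hyA.dvd_of_dvd_pow_mul hya n ⟨φ y ^ K * φ e, ?_⟩
    rw [h, map_mul, ← hK]; ring
  refine ⟨ha.ne_zero, ha.not_isUnit, ?_⟩
  rintro b c ⟨d, hd⟩
  obtain ⟨n, b', hb'⟩ := hfrac b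
  obtain ⟨m, c', hc'⟩ := hfrac c
  obtain ⟨l, d', hd'⟩ := hfrac d
  have h : F ∣ y ^ (K + l) * (b' * c') := ⟨y ^ (n + m) * d', hφ <| by
    simp only [map_mul, map_pow, ← hb', ← hc', ← hd', ← hK]
    linear_combination (φ y ^ (K + l + n + m)) * hd⟩
  rcases hF.dvd_or_dvd h with h | h
  · exact absurd h (hFy _)
  rcases hF.dvd_or_dvd h with h | h
  · exact Or.inl (key b b' n hb' h)
  · exact Or.inr (key c c' m hc' h)

theorem Polynomial.exists_eq_monomial_of_mul_eq_monomial {A : Type*} [CommRing A]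
    [IsDomain A] {p q : Polynomial A} {d : ℕ} {a : A} (ha : a ≠ 0)
    (h : p * q = Polynomial.monomial d a) :
    ∃ r s x y, r + s = d ∧ p = Polynomial.monomial r x ∧ q = Polynomial.monomial s y := by
  have h0 : p * q ≠ 0 := by rw [h]; simpa using ha
  have hp : p ≠ 0 := left_ne_zero_of_mul h0
  have hq : q ≠ 0 := right_ne_zero_of_mul h0
  have h1 := Polynomial.natDegree_mul hp hq
  have h2 := Polynomial.natTrailingDegree_mul hp hq
  rw [h, Polynomial.natDegree_monomial_eq d ha] at h1
  rw [h, Polynomial.natTrailingDegree_monomial ha] at h2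
  have h3 := Polynomial.natTrailingDegree_le_natDegree p
  have h4 := Polynomial.natTrailingDegree_le_natDegree q
  have mono : ∀ r : Polynomial A, r.natTrailingDegree = r.natDegree →
      r = Polynomial.monomial r.natDegree (r.coeff r.natDegree) := by
    intro r hr
    ext n
    rw [Polynomial.coeff_monomial]
    split_ifs with hn
    · rw [hn]
    · rcases lt_or_gt_of_ne hn with hn | hn
      · exact Polynomial.coeff_eq_zero_of_natDegree_lt hn
      · exact Polynomial.coeff_eq_zero_of_lt_natTrailingDegree (hr ▸ hn)
  exact ⟨_, _, _, _, h1.symm, mono p (by omega), mono q (by omega)⟩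

namespace MvPolynomial

variable {τ k : Type*} [Field k]

/-- The ring homomorphism recording the images of all homogeneous components. -/
noncomputable def homogenizeHom {A : Type*} [CommRing A] (φ : MvPolynomial τ k →+* A) :
    MvPolynomial τ k →+* Polynomial A :=
  eval₂Hom (Polynomial.C.comp (φ.comp C)) fun i => Polynomial.C (φ (X i)) * Polynomial.X

theorem coeff_homogenizeHom {A : Type*} [CommRing A] (φ : MvPolynomial τ k →+* A)
    (p : MvPolynomial τ k) (d : ℕ) :
    (homogenizeHom φ p).coeff d = φ (homogeneousComponent d p) := by
  induction p using MvPolynomial.induction_on' with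
  | add p q hp hq => simp [hp, hq]
  | monomial m a =>
    have h1 : homogenizeHom φ (monomial m a) =
        Polynomial.monomial m.degree (φ (monomial m a)) := by
      rw [homogenizeHom, coe_eval₂Hom, eval₂_monomial, monomial_eq (s := m)]
      simp only [mul_pow, Finsupp.prod, Finset.prod_mul_distrib, map_mul, map_prod, map_pow,
        RingHom.comp_apply, Finset.prod_pow_eq_pow_sum, ← Polynomial.C_mul_X_pow_eq_monomial,
        Finsupp.degree]
      simp only [mul_assoc]
      rfl
    have h2 : homogeneousComponent d (monomial m a) =
        if m.degree = d then monomial m a else 0 :=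
      homogeneousComponent_of_mem (isHomogeneous_monomial a rfl) |>.trans (by
        simp [eq_comm])
    rw [h1, h2, Polynomial.coeff_monomial]
    split_ifs <;> simp

theorem eval_one_homogenizeHom {A : Type*} [CommRing A] (φ : MvPolynomial τ k →+* A)
    (p : MvPolynomial τ k) : (homogenizeHom φ p).eval 1 = φ p := by
  have : (Polynomial.evalRingHom (1 : A)).comp (homogenizeHom φ) = φ := by
    ext i <;> simp [homogenizeHom]
  exact congrArg (fun g : MvPolynomial τ k →+* A => g p) this

theorem IsHomogeneous.homogenizeHom_eq {A : Type*} [CommRing A] {f : MvPolynomial τ k} {d : ℕ}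
    (hf : f.IsHomogeneous d) (φ : MvPolynomial τ k →+* A) :
    homogenizeHom φ f = Polynomial.monomial d (φ f) := by
  ext e
  rw [coeff_homogenizeHom, homogeneousComponent_of_mem hf, Polynomial.coeff_monomial]
  split_ifs with h1 h2 h2
  · rfl
  · exact absurd h1.symm h2
  · exact absurd h2.symm h1
  · simp

/-- Factorizations of a quadratic form modulo a homogeneous prime are trivial or given by linear
forms. -/
theorem IsHomogeneous.factor_quadratic {A : Type*} [CommRing A] [IsDomain A]
    {φ : MvPolynomial τ k →+* A}
    (hker : ∀ p, φ p = 0 → ∀ d, φ (homogeneousComponent d p) = 0) {f u v : MvPolynomial τ k}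
    (hf : f.IsHomogeneous 2) (hf0 : φ f ≠ 0) (huv : φ f = φ u * φ v) :
    IsUnit (φ u) ∨ IsUnit (φ v) ∨ ∃ ℓ m : MvPolynomial τ k,
      ℓ.IsHomogeneous 1 ∧ m.IsHomogeneous 1 ∧ φ f = φ (ℓ * m) := by
  have hH : homogenizeHom φ f = homogenizeHom φ u * homogenizeHom φ v := by
    rw [← map_mul, ← sub_eq_zero, ← map_sub]
    ext d
    rw [coeff_homogenizeHom, Polynomial.coeff_zero]
    exact hker _ (by rw [map_sub, map_mul, huv, sub_self]) d
  obtain ⟨r, s, x, y, hrs, hx, hy⟩ :=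
    Polynomial.exists_eq_monomial_of_mul_eq_monomial hf0 (hH.symm.trans (hf.homogenizeHom_eq φ))
  have comp : ∀ {p : MvPolynomial τ k} {r : ℕ} {x : A},
      homogenizeHom φ p = Polynomial.monomial r x → φ p = φ (homogeneousComponent r p) := by
    intro p r x hx
    rw [← eval_one_homogenizeHom φ p, ← coeff_homogenizeHom, hx]
    simp
  have unit : ∀ {p : MvPolynomial τ k}, φ p ≠ 0 → φ p = φ (homogeneousComponent 0 p) →
      IsUnit (φ p) := by
    intro p hp h
    rw [homogeneousComponent_zero] at h
    rw [h] at hp ⊢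
    have hc : coeff 0 p ≠ 0 := fun h0 => hp (by rw [h0]; simp)
    exact ((hc.isUnit).map C).map φ
  have hu0 : φ u ≠ 0 := left_ne_zero_of_mul (huv ▸ hf0)
  have hv0 : φ v ≠ 0 := right_ne_zero_of_mul (huv ▸ hf0)
  have hr : r = 0 ∨ s = 0 ∨ (r = 1 ∧ s = 1) := by omega
  rcases hr with rfl | rfl | ⟨rfl, rfl⟩
  · exact Or.inl (unit hu0 (comp hx))
  · exact Or.inr (Or.inl (unit hv0 (comp hy)))
  · refine Or.inr (Or.inr ⟨_, _, homogeneousComponent_isHomogeneous 1 u,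
      homogeneousComponent_isHomogeneous 1 v, ?_⟩)
    rw [map_mul, ← comp hx, ← comp hy, huv]

theorem IsHomogeneous.constantCoeff_eq_zero_s3 {f : MvPolynomial τ k} {d : ℕ}
    (hf : f.IsHomogeneous d) (hd : d ≠ 0) : constantCoeff f = 0 := by
  rw [constantCoeff_eq]
  exact hf.coeff_eq_zero (by simpa using hd.symm)

theorem IsHomogeneous.prime_of_not_mul {f : MvPolynomial τ k} (hf : f.IsHomogeneous 2)
    (hprod : ¬ ∃ ℓ m : MvPolynomial τ k, ℓ.IsHomogeneous 1 ∧ m.IsHomogeneous 1 ∧ f = ℓ * m) :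
    Prime f := by
  have hf0 : f ≠ 0 := fun h =>
    hprod ⟨0, 0, isHomogeneous_zero _ _ _, isHomogeneous_zero _ _ _, by simp [h]⟩
  refine UniqueFactorizationMonoid.irreducible_iff_prime.1 ⟨fun h => ?_, fun u v huv => ?_⟩
  · have := h.map (constantCoeff (σ := τ) (R := k))
    rw [hf.constantCoeff_eq_zero_s3 two_ne_zero] at this
    exact not_isUnit_zero this
  · rcases IsHomogeneous.factor_quadratic (φ := RingHom.id _) (fun p hp d => by
      simp only [RingHom.id_apply] at hp ⊢; rw [hp, map_zero]) hf hf0 huv with h | h | h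
    · exact Or.inl h
    · exact Or.inr h
    · exact absurd h hprod

theorem exists_eq_X_mul_add (i : τ) {f : MvPolynomial τ k} {d : ℕ}
    (hf : f.IsHomogeneous (d + 1)) :
    ∃ q r : MvPolynomial τ k, f = X i * q + r ∧ q.IsHomogeneous d ∧ r.IsHomogeneous (d + 1) ∧
      i ∉ r.vars ∧ q.vars ⊆ f.vars ∧ r.vars ⊆ f.vars := by
  classical
  have hmod : ∀ e, coeff e (f.modMonomial (Finsupp.single i 1)) ≠ 0 →
      e i = 0 ∧ coeff e f ≠ 0 := by
    intro e he
    by_cases hle : Finsupp.single i 1 ≤ e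
    · exact absurd (coeff_modMonomial_of_le _ hle) he
    · rw [coeff_modMonomial_of_not_le _ hle] at he
      rw [Finsupp.single_le_iff] at hle
      exact ⟨by omega, he⟩
  refine ⟨f.divMonomial (Finsupp.single i 1), f.modMonomial (Finsupp.single i 1),
    (divMonomial_add_modMonomial_single f i).symm, ?_, ?_, ?_, ?_, ?_⟩
  · intro e he
    rw [coeff_divMonomial] at he
    have := hf he
    rw [map_add, Finsupp.weight_single] at this
    simp only [Pi.one_apply, smul_eq_mul, mul_one] at this
    omega
  · intro e he
    exact hf (hmod e he).2
  · rw [mem_vars_iff_mem_support]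
    rintro ⟨e, he, hi⟩
    exact Finsupp.mem_support_iff.1 hi (hmod e (mem_support_iff.1 he)).1
  · intro l hl
    rw [mem_vars_iff_mem_support] at hl ⊢
    obtain ⟨e, he, hi⟩ := hl
    rw [mem_support_iff, coeff_divMonomial] at he
    refine ⟨_, mem_support_iff.2 he, ?_⟩
    rw [Finsupp.mem_support_iff] at hi ⊢
    rw [Finsupp.add_apply]
    omega
  · intro l hl
    rw [mem_vars_iff_mem_support] at hl ⊢
    obtain ⟨e, he, hi⟩ := hl
    exact ⟨e, mem_support_iff.2 (hmod e (mem_support_iff.1 he)).2, hi⟩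

theorem IsHomogeneous.vars_nonempty {f : MvPolynomial τ k} {d : ℕ} (hf : f.IsHomogeneous d)
    (hd : d ≠ 0) (hf0 : f ≠ 0) : f.vars.Nonempty := by
  rw [Finset.nonempty_iff_ne_empty]
  intro h
  obtain ⟨c, rfl⟩ : ∃ c, f = C c := by
    have := exists_rename_eq_of_vars_subset_range f (Empty.elim : Empty → τ)
      (fun x => x.elim) (by simp [h])
    obtain ⟨q, rfl⟩ := this
    exact ⟨_, by rw [eq_C_of_isEmpty q, rename_C]⟩
  have := hf.constantCoeff_eq_zero_s3 hd
  rw [constantCoeff_C] at this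
  exact hf0 (by rw [this, C_0])

theorem eval_update_of_notMem_vars [DecidableEq τ] {i : τ} {p : MvPolynomial τ k}
    (hi : i ∉ p.vars) (v : τ → k) (t : k) : eval (Function.update v i t) p = eval v p := by
  refine eval₂Hom_congr' rfl (fun j hj _ => ?_) rfl
  rw [Function.update_of_ne]
  rintro rfl
  exact hi hj

theorem IsHomogeneous.eval_single_of_notMem_vars [DecidableEq τ] {i : τ} {p : MvPolynomial τ k}
    {d : ℕ} (hp : p.IsHomogeneous d) (hd : d ≠ 0) (hi : i ∉ p.vars) (t : k) :
    eval (Pi.single i t) p = 0 := by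
  rw [Pi.single, eval_update_of_notMem_vars hi]
  have : eval (0 : τ → k) p = constantCoeff p := by
    rw [← eval_zero]
  exact this.trans (hp.constantCoeff_eq_zero_s3 hd)

theorem IsHomogeneous.exists_eq_C {p : MvPolynomial τ k} (hp : p.IsHomogeneous 0) :
    ∃ c, p = C c :=
  ⟨_, totalDegree_eq_zero_iff_eq_C.1 ((totalDegree_zero_iff_isHomogeneous _).2 hp)⟩

/-- A `k`-algebra automorphism of the polynomial ring preserving the grading. -/
def IsGraded (σ : MvPolynomial τ k ≃ₐ[k] MvPolynomial τ k) : Prop :=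
  ∀ p d, (σ p).IsHomogeneous d ↔ p.IsHomogeneous d

theorem isHomogeneous_algHom (σ : MvPolynomial τ k →ₐ[k] MvPolynomial τ k)
    (h : ∀ i, (σ (X i)).IsHomogeneous 1) {p : MvPolynomial τ k} {d : ℕ}
    (hp : p.IsHomogeneous d) : (σ p).IsHomogeneous d := by
  rw [aeval_unique σ]
  simpa using hp.aeval (σ ∘ X) h

theorem algHom_eq_self_of_vars (σ : MvPolynomial τ k →ₐ[k] MvPolynomial τ k)
    {p : MvPolynomial τ k} (h : ∀ i ∈ p.vars, σ (X i) = X i) : σ p = p := by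
  conv_rhs => rw [← aeval_X_left_apply p]
  rw [aeval_unique σ]
  exact eval₂Hom_congr' rfl (fun i hi _ => h i hi) rfl

theorem vars_algHom_subset (σ : MvPolynomial τ k →ₐ[k] MvPolynomial τ k)
    {p : MvPolynomial τ k} {s : Set τ} (h : ∀ i ∈ p.vars, ((σ (X i)).vars : Set τ) ⊆ s) :
    ((σ p).vars : Set τ) ⊆ s := by
  rw [← mem_supported (R := k)]
  have hp : p ∈ supported k (p.vars : Set τ) := mem_supported.2 subset_rfl
  rw [supported_eq_adjoin_X] at hp
  refine (Algebra.adjoin_le (S := (supported k s).comap σ) ?_) hp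
  rintro _ ⟨i, hi, rfl⟩
  exact mem_supported.2 (h i hi)

/-- Elementary linear substitution in one variable. -/
theorem exists_elementary (j : τ) {c : k} (hc : c ≠ 0) {m : MvPolynomial τ k}
    (hm : m.IsHomogeneous 1) (hj : j ∉ m.vars) :
    ∃ σ : MvPolynomial τ k ≃ₐ[k] MvPolynomial τ k, IsGraded σ ∧ σ (X j) = C c * X j + m ∧
      ∀ l, l ≠ j → σ (X l) = X l := by
  classical
  let F : MvPolynomial τ k →ₐ[k] MvPolynomial τ k :=
    aeval fun l => if l = j then C c * X j + m else X l
  let G : MvPolynomial τ k →ₐ[k] MvPolynomial τ k :=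
    aeval fun l => if l = j then C c⁻¹ * (X j - m) else X l
  have hFj : F (X j) = C c * X j + m := by simp [F]
  have hFl : ∀ l, l ≠ j → F (X l) = X l := fun l hl => by simp [F, hl]
  have hGj : G (X j) = C c⁻¹ * (X j - m) := by simp [G]
  have hGl : ∀ l, l ≠ j → G (X l) = X l := fun l hl => by simp [G, hl]
  have hne : ∀ i ∈ m.vars, i ≠ j := fun i hi h => hj (h ▸ hi)
  have hFm : F m = m := algHom_eq_self_of_vars F fun i hi => hFl i (hne i hi)
  have hGm : G m = m := algHom_eq_self_of_vars G fun i hi => hGl i (hne i hi)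
  have hFC : ∀ a, F (C a) = C a := fun a => F.commutes a
  have hGC : ∀ a, G (C a) = C a := fun a => G.commutes a
  have hcc : (C c : MvPolynomial τ k) * C c⁻¹ = 1 := by rw [← MvPolynomial.C_mul, mul_inv_cancel₀ hc, C_1]
  have hFh : ∀ l, (F (X l)).IsHomogeneous 1 := fun l => by
    by_cases hl : l = j
    · rw [hl, hFj]; exact (isHomogeneous_C_mul_X c j).add hm
    · rw [hFl l hl]; exact isHomogeneous_X k l
  have hGh : ∀ l, (G (X l)).IsHomogeneous 1 := fun l => by
    by_cases hl : l = j
    · rw [hl, hGj]; exact ((isHomogeneous_X k j).sub hm).C_mul _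
    · rw [hGl l hl]; exact isHomogeneous_X k l
  let σ : MvPolynomial τ k ≃ₐ[k] MvPolynomial τ k := AlgEquiv.ofAlgHom F G
    (by
      ext1 l
      by_cases hl : l = j
      · subst hl
        simp only [AlgHom.comp_apply, AlgHom.id_apply, hGj, map_mul, map_sub, hFC, hFj, hFm]
        linear_combination (X l) * hcc
      · simp [hGl l hl, hFl l hl])
    (by
      ext1 l
      by_cases hl : l = j
      · subst hl
        simp only [AlgHom.comp_apply, AlgHom.id_apply, hFj, map_mul, map_add, hGC, hGj, hGm]
        linear_combination (X l - m) * hcc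
      · simp [hGl l hl, hFl l hl])
  refine ⟨σ, fun p d => ⟨fun h => ?_, fun h => isHomogeneous_algHom F hFh h⟩, hFj, hFl⟩
  have := isHomogeneous_algHom G hGh h
  rwa [show G (σ p) = p from σ.symm_apply_apply p] at this

/-- `f` becomes `xᵢ xⱼ + g` with `g` free of `xᵢ` in suitable linear coordinates. -/
def HasHyperbolicForm (f : MvPolynomial τ k) : Prop :=
  ∃ σ : MvPolynomial τ k ≃ₐ[k] MvPolynomial τ k, IsGraded σ ∧
    ∃ (i j : τ) (g : MvPolynomial τ k), i ≠ j ∧ i ∉ g.vars ∧ σ f = X i * X j + g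

theorem HasHyperbolicForm.of_apply {f : MvPolynomial τ k}
    {σ : MvPolynomial τ k ≃ₐ[k] MvPolynomial τ k} (hσ : IsGraded σ)
    (h : HasHyperbolicForm (σ f)) : HasHyperbolicForm f := by
  obtain ⟨ρ, hρ, i, j, g, hij, hg, e⟩ := h
  exact ⟨σ.trans ρ, fun p d => (hρ _ d).trans (hσ p d), i, j, g, hij, hg, e⟩

theorem exists_eq_quadratic (i : τ) {f : MvPolynomial τ k} (hf : f.IsHomogeneous 2) :
    ∃ (a : k) (ℓ r : MvPolynomial τ k), f = X i * (C a * X i + ℓ) + r ∧ ℓ.IsHomogeneous 1 ∧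
      r.IsHomogeneous 2 ∧ i ∉ ℓ.vars ∧ i ∉ r.vars := by
  obtain ⟨q, r, h1, hq, hr, hir, -, -⟩ := exists_eq_X_mul_add i hf
  obtain ⟨q', ℓ, h2, hq', hℓ, hiℓ, -, -⟩ := exists_eq_X_mul_add i hq
  obtain ⟨a, rfl⟩ := hq'.exists_eq_C
  exact ⟨a, ℓ, r, by rw [h1, h2, mul_comm (C a)], hℓ, hr, hiℓ, hir⟩

theorem IsHomogeneous.hasHyperbolicForm_of_eval_single [DecidableEq τ] {f : MvPolynomial τ k}
    (hf : f.IsHomogeneous 2) {j : τ} (hj : j ∈ f.vars) (hev : eval (Pi.single j 1) f = 0) :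
    HasHyperbolicForm f := by
  obtain ⟨a, ℓ, r, h1, hℓ, hr, hjℓ, hjr⟩ := exists_eq_quadratic j hf
  have ha : a = 0 := by
    rw [h1] at hev
    simpa [hℓ.eval_single_of_notMem_vars one_ne_zero hjℓ,
      hr.eval_single_of_notMem_vars two_ne_zero hjr] using hev
  rw [ha, C_0, zero_mul, zero_add] at h1
  have hℓ0 : ℓ ≠ 0 := by
    rintro rfl
    rw [mul_zero, zero_add] at h1
    exact hjr (h1 ▸ hj)
  obtain ⟨l, hl⟩ := hℓ.vars_nonempty one_ne_zero hℓ0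
  obtain ⟨q, m, h2, hq, hm, hlm, -, hmv⟩ := exists_eq_X_mul_add l hℓ
  obtain ⟨c, rfl⟩ := hq.exists_eq_C
  have hlj : l ≠ j := fun h => hjℓ (h ▸ hl)
  have hc : c ≠ 0 := by
    rintro rfl
    rw [C_0, mul_zero, zero_add] at h2
    exact hlm (h2 ▸ hl)
  have hcc : (C c : MvPolynomial τ k) * C c⁻¹ = 1 := by rw [← MvPolynomial.C_mul, mul_inv_cancel₀ hc, C_1]
  have hv : (C (-c⁻¹) * m).vars ⊆ m.vars := by
    refine (vars_mul _ _).trans ?_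
    rw [vars_C, Finset.empty_union]
  obtain ⟨σ, hσ, hσl, hσo⟩ := exists_elementary l (inv_ne_zero hc) (m := C (-c⁻¹) * m)
    (hm.C_mul (-c⁻¹)) (fun h => hlm (hv h))
  have hσm : σ m = m := algHom_eq_self_of_vars σ.toAlgHom fun i hi =>
    hσo i fun h => hlm (h ▸ hi)
  have hσC : σ (C c) = C c := σ.commutes c
  have hσℓ : σ ℓ = X l := by
    rw [h2, map_add, map_mul, hσl, hσm, hσC, C_neg]
    linear_combination (X l - m) * hcc
  refine ⟨σ, hσ, j, l, σ r, hlj.symm, ?_, ?_⟩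
  · have : ((σ r).vars : Set τ) ⊆ {j}ᶜ := by
      refine vars_algHom_subset σ.toAlgHom fun i hi => ?_
      have hij : i ≠ j := fun h => hjr (h ▸ hi)
      rcases eq_or_ne i l with rfl | hil
      · change ((σ (X i)).vars : Set τ) ⊆ {j}ᶜ
        rw [hσl, Set.subset_compl_singleton_iff]
        intro h
        rcases Finset.mem_union.1 (vars_add_subset _ _ h) with h | h
        · have := vars_mul _ _ h
          rw [vars_C, Finset.empty_union, vars_X, Finset.mem_singleton] at this
          exact hij this.symm
        · exact hjℓ (hmv (hv h))
      · change ((σ (X i)).vars : Set τ) ⊆ {j}ᶜ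
        rw [hσo i hil, vars_X]
        simpa using hij.symm
    exact fun h => this h rfl
  · rw [h1, map_add, map_mul, hσℓ, hσo j hlj.symm]

theorem IsHomogeneous.hasHyperbolicForm [IsAlgClosed k] (N : ℕ) : ∀ {f : MvPolynomial τ k},
    f.vars.card = N → f.IsHomogeneous 2 →
    (¬ ∃ ℓ m : MvPolynomial τ k, ℓ.IsHomogeneous 1 ∧ m.IsHomogeneous 1 ∧ f = ℓ * m) →
    HasHyperbolicForm f := by
  classical
  induction N using Nat.strong_induction_on with
  | _ N ih =>
  intro f hN hf hprod
  have hf0 : f ≠ 0 := (hf.prime_of_not_mul hprod).ne_zero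
  obtain ⟨i, hi⟩ := hf.vars_nonempty two_ne_zero hf0
  by_cases hev : eval (Pi.single i 1) f = 0
  · exact hf.hasHyperbolicForm_of_eval_single hi hev
  obtain ⟨j, hj, hji⟩ : ∃ j ∈ f.vars, j ≠ i := by
    by_contra! h
    obtain ⟨q, r, h1, hq, hr, hir, -, hrv⟩ := exists_eq_X_mul_add i hf
    have hr0 : r = 0 := by
      by_contra hr0
      obtain ⟨l, hl⟩ := hr.vars_nonempty two_ne_zero hr0
      exact hir (h l (hrv hl) ▸ hl)
    exact hprod ⟨X i, q, isHomogeneous_X k i, hq, by rw [h1, hr0, add_zero]⟩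
  obtain ⟨a, ℓ, r, h1, hℓ, hr, hiℓ, hir⟩ := exists_eq_quadratic i hf
  have ha : a ≠ 0 := by
    rintro rfl
    refine hev ?_
    rw [h1]
    simp [hℓ.eval_single_of_notMem_vars one_ne_zero hiℓ,
      hr.eval_single_of_notMem_vars two_ne_zero hir]
  obtain ⟨α, hα⟩ : ∃ α : k, eval (Function.update (Pi.single j 1) i α) f = 0 := by
    obtain ⟨α, hα⟩ := IsAlgClosed.exists_root
      (Polynomial.C a * Polynomial.X ^ 2 + Polynomial.C (eval (Pi.single j 1) ℓ) * Polynomial.X +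
        Polynomial.C (eval (Pi.single j 1) r)) (by
          rw [Polynomial.degree_quadratic ha]; decide)
    refine ⟨α, ?_⟩
    simp only [Polynomial.IsRoot, Polynomial.eval_add, Polynomial.eval_mul, Polynomial.eval_C,
      Polynomial.eval_pow, Polynomial.eval_X] at hα
    rw [h1]
    simp only [map_add, map_mul, eval_X, eval_C, eval_update_of_notMem_vars hiℓ,
      eval_update_of_notMem_vars hir, Function.update_self]
    linear_combination hα
  obtain ⟨σ, hσ, hσi, hσo⟩ := exists_elementary i one_ne_zero
    (isHomogeneous_C_mul_X α j) (fun h => by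
      have := vars_mul _ _ h
      rw [vars_C, Finset.empty_union, vars_X, Finset.mem_singleton] at this
      exact hji this.symm)
  have hσf : (σ f).IsHomogeneous 2 := (hσ f 2).2 hf
  have hσprod : ¬ ∃ ℓ m : MvPolynomial τ k, ℓ.IsHomogeneous 1 ∧ m.IsHomogeneous 1 ∧
      σ f = ℓ * m := by
    rintro ⟨u, v, hu, hv, huv⟩
    refine hprod ⟨σ.symm u, σ.symm v, (hσ _ _).1 (by simpa), (hσ _ _).1 (by simpa), ?_⟩
    rw [← map_mul, ← huv, AlgEquiv.symm_apply_apply]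
  have hσvars : (σ f).vars ⊆ f.vars := by
    refine Finset.coe_subset.1 (vars_algHom_subset σ.toAlgHom fun l hl => ?_)
    change ((σ (X l)).vars : Set τ) ⊆ f.vars
    rcases eq_or_ne l i with rfl | hli
    · rw [hσi, Finset.coe_subset]
      refine (vars_add_subset _ _).trans (Finset.union_subset ?_ ?_) <;>
      · refine (vars_mul _ _).trans ?_
        rw [vars_C, Finset.empty_union, vars_X, Finset.singleton_subset_iff]
        assumption
    · rw [hσo l hli, vars_X]
      simpa using hl
  have hσev : eval (Pi.single j 1) (σ f) = 0 := by
    have : (MvPolynomial.aeval (Pi.single j 1 : τ → k)).comp σ.toAlgHom =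
        MvPolynomial.aeval (Function.update (Pi.single j 1) i α) := by
      ext l
      change MvPolynomial.aeval (Pi.single j 1 : τ → k) (σ (X l)) = _
      rcases eq_or_ne l i with rfl | hli
      · rw [hσi]
        simp [hji.symm]
      · rw [hσo l hli]
        simp [hli]
    rw [← coe_aeval_eq_eval] at hα ⊢
    exact (DFunLike.congr_fun this f).trans hα
  by_cases hjσ : j ∈ (σ f).vars
  · exact (hσf.hasHyperbolicForm_of_eval_single hjσ hσev).of_apply hσ
  · refine (ih _ ?_ rfl hσf hσprod).of_apply hσ
    rw [← hN]
    exact Finset.card_lt_card ⟨hσvars, fun h => hjσ (h hj)⟩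

theorem IsHomogeneous.homogeneousComponent_mul_eq_ite {f : MvPolynomial τ k} {d : ℕ}
    (hf : f.IsHomogeneous d) (p : MvPolynomial τ k) (e : ℕ) :
    homogeneousComponent e (p * f) = if d ≤ e then homogeneousComponent (e - d) p * f else 0 := by
  have h := coeff_homogenizeHom (RingHom.id (MvPolynomial τ k)) (p * f) e
  rw [map_mul, hf.homogenizeHom_eq, ← Polynomial.C_mul_X_pow_eq_monomial, ← mul_assoc,
    Polynomial.coeff_mul_X_pow', Polynomial.coeff_mul_C, coeff_homogenizeHom] at h
  exact h.symm

theorem IsHomogeneous.homogeneousComponent_mul {f : MvPolynomial τ k} {d : ℕ}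
    (hf : f.IsHomogeneous d) (p : MvPolynomial τ k) :
    homogeneousComponent d (p * f) = C (constantCoeff p) * f := by
  rw [hf.homogeneousComponent_mul_eq_ite, if_pos le_rfl, Nat.sub_self, homogeneousComponent_zero,
    constantCoeff_eq]

theorem IsHomogeneous.homogeneousComponent_mem_span_singleton {f p : MvPolynomial τ k} {d : ℕ}
    (hf : f.IsHomogeneous d) (hp : p ∈ Ideal.span {f}) (e : ℕ) :
    homogeneousComponent e p ∈ Ideal.span {f} := by
  obtain ⟨t, rfl⟩ := Ideal.mem_span_singleton'.1 hp
  rw [hf.homogeneousComponent_mul_eq_ite]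
  split_ifs
  · exact Ideal.mul_mem_left _ _ (Ideal.mem_span_singleton_self f)
  · exact Ideal.zero_mem _

/-- The strength of the quadratic form `f` is at least two. -/
def NotSumTwoProducts (f : MvPolynomial τ k) : Prop :=
  ¬ ∃ ℓ₁ ℓ₂ m₁ m₂ : MvPolynomial τ k, ℓ₁.IsHomogeneous 1 ∧ ℓ₂.IsHomogeneous 1 ∧
    m₁.IsHomogeneous 1 ∧ m₂.IsHomogeneous 1 ∧ f = ℓ₁ * m₁ + ℓ₂ * m₂

theorem NotSumTwoProducts.not_mul {f : MvPolynomial τ k} (hf : NotSumTwoProducts f) :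
    ¬ ∃ ℓ m : MvPolynomial τ k, ℓ.IsHomogeneous 1 ∧ m.IsHomogeneous 1 ∧ f = ℓ * m := by
  rintro ⟨ℓ, m, hℓ, hm, h⟩
  exact hf ⟨ℓ, 0, m, 0, hℓ, isHomogeneous_zero _ _ _, hm, isHomogeneous_zero _ _ _, by simp [h]⟩

theorem NotSumTwoProducts.apply {f : MvPolynomial τ k} (hf : NotSumTwoProducts f)
    {σ : MvPolynomial τ k ≃ₐ[k] MvPolynomial τ k} (hσ : IsGraded σ) :
    NotSumTwoProducts (σ f) := by
  rintro ⟨a, b, c, d, ha, hb, hc, hd, h⟩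
  refine hf ⟨σ.symm a, σ.symm b, σ.symm c, σ.symm d, (hσ _ _).1 (by simpa),
    (hσ _ _).1 (by simpa), (hσ _ _).1 (by simpa), (hσ _ _).1 (by simpa), ?_⟩
  rw [← map_mul, ← map_mul, ← map_add, ← h, AlgEquiv.symm_apply_apply]

theorem prime_mk_X {f : MvPolynomial τ k} (hf : f.IsHomogeneous 2) (hs : NotSumTwoProducts f)
    (j : τ) : Prime (Ideal.Quotient.mk (Ideal.span {f}) (X j)) := by
  classical
  obtain ⟨q, r, h1, hq, hr, hjr, -, -⟩ := exists_eq_X_mul_add j hf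
  have hrp : Prime r := hr.prime_of_not_mul fun ⟨ℓ, m, hℓ, hm, h⟩ =>
    hs ⟨X j, ℓ, q, m, isHomogeneous_X k j, hℓ, hq, hm, by rw [h1, h]⟩
  let π : MvPolynomial τ k →ₐ[k] MvPolynomial τ k := aeval fun l => if l = j then 0 else X l
  have hπj : π (X j) = 0 := by simp [π]
  have hπl : ∀ l, l ≠ j → π (X l) = X l := fun l hl => by simp [π, hl]
  have hπr : π r = r := algHom_eq_self_of_vars π fun i hi => hπl i fun h => hjr (h ▸ hi)
  have hπf : π f = r := by rw [h1, map_add, map_mul, hπj, zero_mul, zero_add, hπr]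
  have hsub : ∀ p, X j ∣ p - π p := by
    intro p
    induction p using MvPolynomial.induction_on with
    | C a => rw [show π (C a) = C a from π.commutes a, sub_self]; exact dvd_zero _
    | add p q hp hq =>
      rw [map_add, add_sub_add_comm]
      exact dvd_add hp hq
    | mul_X p l hp =>
      rw [map_mul]
      rcases eq_or_ne l j with rfl | hl
      · rw [hπj, mul_zero, sub_zero]
        exact dvd_mul_left _ _
      · rw [hπl l hl, ← sub_mul]
        exact hp.mul_right _
  have hdvd : ∀ p, Ideal.Quotient.mk (Ideal.span {f}) (X j) ∣ Ideal.Quotient.mk _ p ↔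
      r ∣ π p := by
    intro p
    constructor
    · rintro ⟨s, hs⟩
      obtain ⟨s, rfl⟩ := Ideal.Quotient.mk_surjective s
      rw [← map_mul, Ideal.Quotient.eq, Ideal.mem_span_singleton] at hs
      obtain ⟨t, ht⟩ := hs
      have := congrArg π ht
      rw [map_sub, map_mul, map_mul, hπj, zero_mul, sub_zero, hπf] at this
      exact ⟨_, this⟩
    · rintro ⟨t, ht⟩
      obtain ⟨s, hs⟩ := hsub p
      refine ⟨Ideal.Quotient.mk _ (s - q * t), ?_⟩
      rw [← map_mul, Ideal.Quotient.eq, Ideal.mem_span_singleton]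
      exact ⟨t, by rw [h1]; linear_combination hs + ht⟩
  refine ⟨?_, ?_, ?_⟩
  · rw [Ne, Ideal.Quotient.eq_zero_iff_mem, Ideal.mem_span_singleton]
    rintro ⟨t, ht⟩
    have hf0 : f ≠ 0 := (hf.prime_of_not_mul hs.not_mul).ne_zero
    have ht0 : t ≠ 0 := by
      rintro rfl
      rw [mul_zero] at ht
      exact X_ne_zero j ht
    have hd := congrArg totalDegree ht
    rw [totalDegree_X, totalDegree_mul_of_isDomain hf0 ht0, hf.totalDegree hf0] at hd
    omega
  · intro h
    have := (hdvd 1).1 (by rw [map_one]; exact h.dvd)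
    rw [map_one] at this
    exact hrp.not_isUnit (isUnit_of_dvd_one this)
  · intro a b hab
    obtain ⟨a, rfl⟩ := Ideal.Quotient.mk_surjective a
    obtain ⟨b, rfl⟩ := Ideal.Quotient.mk_surjective b
    rw [← map_mul, hdvd, map_mul] at hab
    rw [hdvd, hdvd]
    exact hrp.dvd_or_dvd hab

theorem prime_mk_of_irreducible {f : MvPolynomial τ k} (hf : f.IsHomogeneous 2)
    (hs : NotSumTwoProducts f) {i j : τ} {g : MvPolynomial τ k} (hij : i ≠ j) (hg : i ∉ g.vars)
    (hfg : f = X i * X j + g) {a : MvPolynomial τ k ⧸ Ideal.span {f}} (ha : Irreducible a) :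
    Prime a := by
  classical
  have hfp := hf.prime_of_not_mul hs.not_mul
  have : (Ideal.span {f}).IsPrime := (Ideal.span_singleton_prime hfp.ne_zero).2 hfp
  let φ : MvPolynomial {l // l ≠ i} k →+* MvPolynomial τ k ⧸ Ideal.span {f} :=
    (Ideal.Quotient.mk _).comp (rename Subtype.val).toRingHom
  have hφ : ∀ b, φ b = Ideal.Quotient.mk _ (rename Subtype.val b) := fun b => rfl
  obtain ⟨g', hg'⟩ := exists_rename_eq_of_vars_subset_range g (Subtype.val : {l // l ≠ i} → τ)
    Subtype.val_injective (by
      intro l hl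
      exact ⟨⟨l, fun h => hg (h ▸ hl)⟩, rfl⟩)
  have hinotin : ∀ b : MvPolynomial {l // l ≠ i} k, i ∉ (rename Subtype.val b).vars := by
    intro b hb
    obtain ⟨l, -, hl⟩ := Finset.mem_image.1 (vars_rename _ _ hb)
    exact l.2 hl
  have hinj : Function.Injective φ := by
    rw [injective_iff_map_eq_zero]
    intro b hb
    rw [hφ, Ideal.Quotient.eq_zero_iff_mem, Ideal.mem_span_singleton] at hb
    obtain ⟨t, ht⟩ := hb
    by_contra hb0
    have hren : rename Subtype.val b ≠ (0 : MvPolynomial τ k) := fun h =>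
      hb0 (rename_injective _ Subtype.val_injective (by rw [h, map_zero]))
    have ht0 : t ≠ 0 := by
      rintro rfl
      exact hren (by rw [ht, mul_zero])
    have hd := hinotin b
    rw [mem_vars_iff_degreeOf_ne_zero, not_not, ht, degreeOf_mul_eq hfp.ne_zero ht0] at hd
    have hif : i ∉ f.vars := by
      rw [mem_vars_iff_degreeOf_ne_zero, not_not]
      omega
    have h1 : pderiv i f = 0 := pderiv_eq_zero_of_notMem_vars hif
    rw [hfg, map_add, pderiv_mul, pderiv_X_self, pderiv_X_of_ne hij.symm,
      pderiv_eq_zero_of_notMem_vars hg] at h1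
    simp at h1
  have hy : φ (X ⟨j, hij.symm⟩) = Ideal.Quotient.mk _ (X j) := by rw [hφ, rename_X]
  refine ha.prime_of_localization φ hinj (X_prime (i := ⟨j, hij.symm⟩))
    (hy ▸ prime_mk_X hf hs j) ?_
  intro c
  obtain ⟨p, rfl⟩ := Ideal.Quotient.mk_surjective c
  induction p using MvPolynomial.induction_on with
  | C a => exact ⟨0, C a, by rw [pow_zero, one_mul, hφ, rename_C]⟩
  | add p q hp hq =>
    obtain ⟨N, b, hb⟩ := hp
    obtain ⟨M, c, hc⟩ := hq
    refine ⟨N + M, X ⟨j, hij.symm⟩ ^ M * b + X ⟨j, hij.symm⟩ ^ N * c, ?_⟩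
    simp only [map_add, map_mul, map_pow, ← hb, ← hc]
    ring
  | mul_X p l hp =>
    obtain ⟨N, b, hb⟩ := hp
    rcases eq_or_ne l i with rfl | hl
    · refine ⟨N + 1, -(b * g'), ?_⟩
      have h0 : Ideal.Quotient.mk (Ideal.span {f}) (X l) * φ (X ⟨j, hij.symm⟩) + φ g' = 0 := by
        rw [hy, hφ, hg', ← map_mul, ← map_add, ← hfg]
        exact Ideal.Quotient.eq_zero_iff_mem.2 (Ideal.mem_span_singleton_self f)
      rw [map_neg, map_mul, map_mul, ← hb]
      linear_combination (φ (X ⟨j, hij.symm⟩) ^ N * Ideal.Quotient.mk (Ideal.span {f}) p) * h0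
    · refine ⟨N, b * X ⟨l, hl⟩, ?_⟩
      rw [map_mul, map_mul, ← hb, hφ (X ⟨l, hl⟩), rename_X, mul_assoc]

theorem mem_span_pair_or_of_hyperbolic {f f' : MvPolynomial τ k} (hf : f.IsHomogeneous 2)
    (hf' : f'.IsHomogeneous 2) (hs : NotSumTwoProducts f)
    (hs' : ∀ c : k, NotSumTwoProducts (f' + C c * f)) {i j : τ} {g : MvPolynomial τ k}
    (hij : i ≠ j) (hg : i ∉ g.vars) (hfg : f = X i * X j + g) {a b : MvPolynomial τ k}
    (hab : a * b ∈ Ideal.span {f, f'}) : a ∈ Ideal.span {f, f'} ∨ b ∈ Ideal.span {f, f'} := by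
  have hfp := hf.prime_of_not_mul hs.not_mul
  have : (Ideal.span {f}).IsPrime := (Ideal.span_singleton_prime hfp.ne_zero).2 hfp
  have hmem : ∀ p, p ∈ Ideal.span {f, f'} ↔
      Ideal.Quotient.mk (Ideal.span {f}) f' ∣ Ideal.Quotient.mk (Ideal.span {f}) p := by
    intro p
    rw [Ideal.mem_span_pair]
    constructor
    · rintro ⟨s, t, rfl⟩
      refine ⟨Ideal.Quotient.mk _ t, ?_⟩
      rw [← map_mul, Ideal.Quotient.eq, Ideal.mem_span_singleton]
      exact ⟨s, by ring⟩
    · rintro ⟨t, ht⟩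
      obtain ⟨t, rfl⟩ := Ideal.Quotient.mk_surjective t
      rw [← map_mul, Ideal.Quotient.eq, Ideal.mem_span_singleton] at ht
      obtain ⟨s, hs⟩ := ht
      exact ⟨s, t, by linear_combination -hs⟩
  have mul_of_mk : ∀ {h : MvPolynomial τ k}, h.IsHomogeneous 2 →
      Ideal.Quotient.mk (Ideal.span {f}) f' = Ideal.Quotient.mk _ h →
      ∃ c, f' + C c * f = h := by
    intro h hh e
    rw [Ideal.Quotient.eq, Ideal.mem_span_singleton] at e
    obtain ⟨t, ht⟩ := e
    have h1 := hf.homogeneousComponent_mul t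
    rw [mul_comm, ← ht, homogeneousComponent_of_mem (hf'.sub hh), if_pos rfl] at h1
    exact ⟨-constantCoeff t, by rw [C_neg]; linear_combination h1⟩
  have hirr : Irreducible (Ideal.Quotient.mk (Ideal.span {f}) f') := by
    refine ⟨fun h => ?_, fun u v huv => ?_⟩
    · obtain ⟨w, hw⟩ := h.exists_right_inv
      obtain ⟨w, rfl⟩ := Ideal.Quotient.mk_surjective w
      rw [← map_mul, ← map_one (Ideal.Quotient.mk _), Ideal.Quotient.eq,
        Ideal.mem_span_singleton] at hw
      obtain ⟨t, ht⟩ := hw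
      have := congrArg constantCoeff ht
      rw [map_sub, map_mul, map_mul, hf.constantCoeff_eq_zero_s3 two_ne_zero,
        hf'.constantCoeff_eq_zero_s3 two_ne_zero] at this
      simp at this
    · obtain ⟨u, rfl⟩ := Ideal.Quotient.mk_surjective u
      obtain ⟨v, rfl⟩ := Ideal.Quotient.mk_surjective v
      have h0 : Ideal.Quotient.mk (Ideal.span {f}) f' ≠ 0 := by
        intro h0
        obtain ⟨c, hc⟩ := mul_of_mk (isHomogeneous_zero _ _ _) (by rw [h0, map_zero])
        exact (hs' c).not_mul
          ⟨0, 0, isHomogeneous_zero _ _ _, isHomogeneous_zero _ _ _, by rw [hc, mul_zero]⟩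
      rcases hf'.factor_quadratic (φ := Ideal.Quotient.mk (Ideal.span {f})) (fun p hp d => by
        rw [Ideal.Quotient.eq_zero_iff_mem] at hp ⊢
        exact hf.homogeneousComponent_mem_span_singleton hp d) h0 huv with h | h | h
      · exact Or.inl h
      · exact Or.inr h
      · obtain ⟨ℓ, m, hℓ, hm, e⟩ := h
        obtain ⟨c, hc⟩ := mul_of_mk (hℓ.mul hm) e
        exact absurd ⟨ℓ, m, hℓ, hm, hc⟩ (hs' c).not_mul
  have hprime := prime_mk_of_irreducible hf hs hij hg hfg hirr
  rw [hmem, map_mul] at hab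
  rw [hmem, hmem]
  exact hprime.dvd_or_dvd hab

/-- Two quadratic forms generate a prime ideal as soon as every nontrivial combination has
strength at least two. -/
theorem mem_span_pair_or [IsAlgClosed k] {f f' : MvPolynomial τ k} (hf : f.IsHomogeneous 2)
    (hf' : f'.IsHomogeneous 2) (hs : NotSumTwoProducts f)
    (hs' : ∀ c : k, NotSumTwoProducts (f' + C c * f)) {a b : MvPolynomial τ k}
    (hab : a * b ∈ Ideal.span {f, f'}) : a ∈ Ideal.span {f, f'} ∨ b ∈ Ideal.span {f, f'} := by
  obtain ⟨σ, hσ, i, j, g, hij, hg, hfg⟩ := hf.hasHyperbolicForm _ rfl hs.not_mul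
  have hmem : ∀ p, p ∈ Ideal.span {f, f'} ↔ σ p ∈ Ideal.span {σ f, σ f'} := by
    intro p
    simp only [Ideal.mem_span_pair]
    constructor
    · rintro ⟨s, t, rfl⟩
      exact ⟨σ s, σ t, by simp⟩
    · rintro ⟨s, t, h⟩
      exact ⟨σ.symm s, σ.symm t, σ.injective (by simpa using h)⟩
  rw [hmem, hmem]
  rw [hmem, map_mul] at hab
  refine mem_span_pair_or_of_hyperbolic ((hσ f 2).2 hf) ((hσ f' 2).2 hf') (hs.apply hσ)
    (fun c => ?_) hij hg hfg hab
  have := (hs' c).apply hσ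
  rwa [map_add, map_mul, show σ (C c) = C c from σ.commutes c] at this

end MvPolynomial

/-- Over an algebraically closed field of characteristic `≠ 2`, if
`f₁, f₂, f₃` are quadratic forms such that every nontrivial linear combination is nonzero and
cannot be written as `ℓ₁m₁ + ℓ₂m₂` with `ℓ₁, ℓ₂, m₁, m₂` linear forms (collective strength
≥ 2), then `f₁, f₂, f₃` is a regular sequence. -/
theorem stmt_3 {k : Type*} [Field k] [IsAlgClosed k] (hchar : ringChar k ≠ 2)
    (n : ℕ) (hn : 1 ≤ n) (f₁ f₂ f₃ : MvPolynomial (Fin n) k)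
    (hf₁ : f₁.IsHomogeneous 2) (hf₂ : f₂.IsHomogeneous 2) (hf₃ : f₃.IsHomogeneous 2)
    (hstr : ∀ c₁ c₂ c₃ : k, (c₁, c₂, c₃) ≠ (0, 0, 0) →
      c₁ • f₁ + c₂ • f₂ + c₃ • f₃ ≠ 0 ∧
      ¬ ∃ ℓ₁ ℓ₂ m₁ m₂ : MvPolynomial (Fin n) k,
          ℓ₁.IsHomogeneous 1 ∧ ℓ₂.IsHomogeneous 1 ∧ m₁.IsHomogeneous 1 ∧ m₂.IsHomogeneous 1 ∧
          c₁ • f₁ + c₂ • f₂ + c₃ • f₃ = ℓ₁ * m₁ + ℓ₂ * m₂) :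
    RingTheory.Sequence.IsRegular (MvPolynomial (Fin n) k) [f₁, f₂, f₃] := by
  have hs : ∀ c₁ c₂ c₃ : k, (c₁, c₂, c₃) ≠ (0, 0, 0) →
      NotSumTwoProducts (c₁ • f₁ + c₂ • f₂ + c₃ • f₃) := fun c₁ c₂ c₃ h => (hstr c₁ c₂ c₃ h).2
  have hs₁ : NotSumTwoProducts f₁ := by simpa using hs 1 0 0 (by simp)
  have hs₂ : ∀ c : k, NotSumTwoProducts (f₂ + C c * f₁) := fun c => by
    simpa [smul_eq_C_mul, add_comm] using hs c 1 0 (by simp)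
  have hp₁ : Prime f₁ := hf₁.prime_of_not_mul hs₁.not_mul
  have hnot₂ : f₂ ∉ Ideal.span {f₁} := by
    rw [Ideal.mem_span_singleton]
    rintro ⟨t, ht⟩
    have h := hf₁.homogeneousComponent_mul t
    rw [mul_comm, ← ht, homogeneousComponent_of_mem hf₂, if_pos rfl] at h
    refine (hstr (-constantCoeff t) 1 0 (by simp)).1 ?_
    rw [smul_eq_C_mul, C_neg, one_smul, zero_smul]
    linear_combination h
  have hnot₃ : f₃ ∉ Ideal.span {f₁, f₂} := by
    rw [Ideal.mem_span_pair]
    rintro ⟨s, t, h⟩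
    have h' := congrArg (homogeneousComponent 2) h
    rw [map_add, hf₁.homogeneousComponent_mul, hf₂.homogeneousComponent_mul,
      homogeneousComponent_of_mem hf₃, if_pos rfl] at h'
    refine (hstr (-constantCoeff s) (-constantCoeff t) 1 (by simp)).1 ?_
    rw [smul_eq_C_mul, smul_eq_C_mul, C_neg, C_neg, one_smul]
    linear_combination -h'
  rw [RingTheory.Sequence.isRegular_iff, RingTheory.Sequence.isWeaklyRegular_iff_Fin]
  refine ⟨fun i => ?_, fun h => ?_⟩
  · rw [isSMulRegular_quotient_iff_mem_of_smul_mem]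
    intro x hx
    rw [smul_eq_mul, Ideal.mul_top] at hx ⊢
    fin_cases i
    · change f₁ * x ∈ Ideal.ofList [] at hx
      change x ∈ Ideal.ofList []
      rw [Ideal.ofList_nil, Ideal.mem_bot] at hx ⊢
      exact (mul_eq_zero.1 hx).resolve_left hp₁.ne_zero
    · change f₂ * x ∈ Ideal.ofList [f₁] at hx
      change x ∈ Ideal.ofList [f₁]
      rw [Ideal.ofList_singleton, Ideal.mem_span_singleton] at hx ⊢
      rw [Ideal.mem_span_singleton] at hnot₂
      exact (hp₁.dvd_or_dvd hx).resolve_left hnot₂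
    · have e : Ideal.ofList [f₁, f₂] = Ideal.span {f₁, f₂} := by
        rw [Ideal.ofList_cons, Ideal.ofList_singleton, Ideal.span_insert]
      change f₃ * x ∈ Ideal.ofList [f₁, f₂] at hx
      change x ∈ Ideal.ofList [f₁, f₂]
      rw [e] at hx ⊢
      exact (mem_span_pair_or hf₁ hf₂ hs₁ hs₂ hx).resolve_left hnot₃
  · rw [smul_eq_mul, Ideal.mul_top] at h
    have hle : Ideal.ofList [f₁, f₂, f₃] ≤
        RingHom.ker (constantCoeff : MvPolynomial (Fin n) k →+* k) := by
      rw [Ideal.ofList, Ideal.span_le]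
      intro x hx
      simp only [List.mem_cons, List.not_mem_nil, or_false, Set.mem_ofPred_eq] at hx
      rw [SetLike.mem_coe, RingHom.mem_ker]
      rcases hx with rfl | rfl | rfl
      · exact hf₁.constantCoeff_eq_zero_s3 two_ne_zero
      · exact hf₂.constantCoeff_eq_zero_s3 two_ne_zero
      · exact hf₃.constantCoeff_eq_zero_s3 two_ne_zero
    rw [← h, top_le_iff] at hle
    exact RingHom.ker_ne_top _ hle
end

section
/- Let k be a field, let n ≥ 1, and let b₁,…,bₙ ∈ k. Let J be the ideal of k[x₁,…,xₙ] generated by the polynomials (b_j − b_i)·x_i·x_j for all pairs i < j. Then the height of J equals n − max_{t ∈ k} #{ i : b_i = t }, where the maximum is taken over the values t occurring among b₁,…,bₙ. -/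
open MvPolynomial

section CoordinateIdeals

variable {σ k : Type*} [Field k]

/-- The `k`-algebra endomorphism of `k[x_i]` sending the variables in `S` to zero. -/
noncomputable def killVars [DecidableEq σ] (S : Finset σ) :
    MvPolynomial σ k →ₐ[k] MvPolynomial σ k :=
  aeval fun i => if i ∈ S then 0 else X i

lemma ker_killVars [DecidableEq σ] (S : Finset σ) :
    RingHom.ker (killVars (k := k) S) = Ideal.span (X '' (S : Set σ)) := by
  apply le_antisymm
  · have hmk : (Ideal.Quotient.mkₐ k (Ideal.span (X '' (S : Set σ)))).comp (killVars S) =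
        Ideal.Quotient.mkₐ k (Ideal.span (X '' (S : Set σ))) := by
      refine algHom_ext fun i => ?_
      by_cases hi : i ∈ S
      · have : (X i : MvPolynomial σ k) ∈ Ideal.span (X '' (S : Set σ)) :=
          Ideal.subset_span ⟨i, hi, rfl⟩
        simpa [killVars, hi] using (Ideal.Quotient.eq_zero_iff_mem.2 this).symm
      · simp [killVars, hi]
    intro p hp
    have := DFunLike.congr_fun hmk p
    rw [AlgHom.comp_apply, (RingHom.mem_ker).1 hp, map_zero] at this
    exact Ideal.Quotient.eq_zero_iff_mem.1 this.symm
  · rw [Ideal.span_le]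
    rintro _ ⟨i, hi, rfl⟩
    have hi' : i ∈ S := hi
    simp [killVars, hi']

lemma isPrime_span_X_image (S : Finset σ) :
    (Ideal.span (X '' (S : Set σ)) : Ideal (MvPolynomial σ k)).IsPrime := by
  classical
  rw [← ker_killVars]
  exact RingHom.ker_isPrime _

lemma X_mem_span_X_image_iff (S : Finset σ) (i : σ) :
    (X i : MvPolynomial σ k) ∈ Ideal.span (X '' (S : Set σ)) ↔ i ∈ S := by
  classical
  rw [← ker_killVars, RingHom.mem_ker]
  by_cases hi : i ∈ S <;> simp [killVars, hi]

lemma card_le_height_span_X_image (S : Finset σ) :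
    (S.card : ℕ∞) ≤ (Ideal.span (X '' (S : Set σ)) : Ideal (MvPolynomial σ k)).height := by
  classical
  induction S using Finset.induction_on with
  | empty => simp
  | insert a S ha ih =>
    have := isPrime_span_X_image (k := k) S
    have := isPrime_span_X_image (k := k) (insert a S)
    have hlt : (Ideal.span (X '' (S : Set σ)) : Ideal (MvPolynomial σ k)) <
        Ideal.span (X '' ((insert a S : Finset σ) : Set σ)) := by
      refine lt_of_le_not_ge (Ideal.span_mono (Set.image_mono (by simp))) fun h => ha ?_
      exact (X_mem_span_X_image_iff (k := k) S a).1
        (h ((X_mem_span_X_image_iff _ _).2 (Finset.mem_insert_self a S)))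
    rw [Finset.card_insert_of_notMem ha, Nat.cast_add, Nat.cast_one]
    exact (add_le_add_left ih 1).trans (Ideal.height_add_one_le_of_lt_of_isPrime hlt)

lemma height_span_X_image_le_card [Finite σ] (S : Finset σ) :
    (Ideal.span (X '' (S : Set σ)) : Ideal (MvPolynomial σ k)).height ≤ S.card := by
  classical
  have := isPrime_span_X_image (k := k) S
  have h := Ideal.height_le_card_of_mem_minimalPrimes_span_finset
    (p := Ideal.span (X '' (S : Set σ))) (s := S.image (X : σ → MvPolynomial σ k))
    (by rw [Finset.coe_image, Ideal.minimalPrimes_eq_subsingleton_self]; rfl)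
  exact h.trans (by exact_mod_cast Finset.card_image_le)

end CoordinateIdeals

/-- For `b₁,…,bₙ ∈ k`, the ideal `J` of `k[x₁,…,xₙ]` generated by the
polynomials `(b_j − b_i)·x_i·x_j` for `i < j` has height `n − max_t #{i : b_i = t}`, the
maximum being over the values occurring among the `b_i`. -/
theorem stmt_4 {k : Type*} [Field k] [DecidableEq k] (n : ℕ) (hn : 1 ≤ n) (b : Fin n → k) :
    idealHeight (Ideal.span
        {p : MvPolynomial (Fin n) k | ∃ i j : Fin n, i < j ∧
          p = C (b j - b i) * (X i * X j)}) =
      ((n - (Finset.univ.image b).sup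
          (fun t => (Finset.univ.filter (fun i => b i = t)).card) : ℕ) : ℕ∞) := by
  classical
  apply le_antisymm
  · have hne : (Finset.univ.image b).Nonempty := ⟨b ⟨0, hn⟩, by simp⟩
    obtain ⟨t, -, ht⟩ := Finset.exists_mem_eq_sup _ hne
      (fun t => (Finset.univ.filter (fun i => b i = t)).card)
    rw [ht]
    set S : Finset (Fin n) := Finset.univ.filter (fun i => ¬ b i = t) with hS
    have hcard : n - (Finset.univ.filter (fun i => b i = t)).card = S.card := by
      have := Finset.card_filter_add_card_filter_not (s := (Finset.univ : Finset (Fin n)))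
        (fun i => b i = t)
      rw [Finset.card_univ, Fintype.card_fin, ← hS] at this
      omega
    rw [hcard]
    refine (iInf₂_le (⟨_, isPrime_span_X_image (k := k) S⟩ : PrimeSpectrum _) ?_).trans ?_
    · rw [Set.mem_ofPred_eq, Ideal.span_le]
      rintro _ ⟨i, j, -, rfl⟩
      by_cases hi : b i = t
      · by_cases hj : b j = t
        · simp [hi, hj]
        · exact Ideal.mul_mem_left _ _ (Ideal.mul_mem_left _ _
            ((X_mem_span_X_image_iff S j).2 (by simp [hS, hj])))
      · exact Ideal.mul_mem_left _ _ (Ideal.mul_mem_right _ _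
          ((X_mem_span_X_image_iff S i).2 (by simp [hS, hi])))
    · rw [← PrimeSpectrum.height_eq_orderHeight]
      exact height_span_X_image_le_card S
  · refine le_iInf₂ fun p hp => ?_
    rw [Set.mem_ofPred_eq] at hp
    set T : Finset (Fin n) :=
      Finset.univ.filter (fun i => (X i : MvPolynomial (Fin n) k) ∉ p.asIdeal) with hT
    have hconst : ∀ i ∈ T, ∀ j ∈ T, i < j → b j = b i := by
      intro i hi j hj hij
      by_contra hb
      have hmem : C (b j - b i) * (X i * X j) ∈ p.asIdeal :=
        hp (Ideal.subset_span ⟨i, j, hij, rfl⟩)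
      have hunit : IsUnit (C (b j - b i) : MvPolynomial (Fin n) k) :=
        (isUnit_iff_ne_zero.2 (sub_ne_zero.2 hb)).map C
      rcases p.2.mem_or_mem ((Ideal.unit_mul_mem_iff_mem _ hunit).1 hmem) with h | h
      · simp [hT, h] at hi
      · simp [hT, h] at hj
    have hTcard : T.card ≤ (Finset.univ.image b).sup
        (fun t => (Finset.univ.filter (fun i => b i = t)).card) := by
      rcases T.eq_empty_or_nonempty with h | ⟨i, hi⟩
      · simp [h]
      · refine le_trans (Finset.card_le_card fun j hj => ?_)
          (Finset.le_sup (f := fun t => (Finset.univ.filter (fun i => b i = t)).card)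
            (Finset.mem_image_of_mem b (Finset.mem_univ i)))
        rw [Finset.mem_filter]
        refine ⟨Finset.mem_univ j, ?_⟩
        rcases lt_trichotomy i j with h | h | h
        · exact hconst i hi j hj h
        · rw [h]
        · exact (hconst j hj i hi h).symm
    have hle : Ideal.span (X '' ((Tᶜ : Finset (Fin n)) : Set (Fin n))) ≤ p.asIdeal := by
      rw [Ideal.span_le]
      rintro _ ⟨i, hi, rfl⟩
      simpa [hT] using hi
    rw [← PrimeSpectrum.height_eq_orderHeight]
    refine le_trans ?_ ((card_le_height_span_X_image Tᶜ).trans (Ideal.height_mono hle))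
    rw [Finset.card_compl, Fintype.card_fin]
    exact_mod_cast Nat.sub_le_sub_left hTcard n
end

section
/- Let k be a field, let n ≥ 1, and let R = k[x_{ij} : 1 ≤ i ≤ n+1, 1 ≤ j ≤ n] be the polynomial ring in the entries of a generic (n+1)×n matrix Φ = (x_{ij}). For 1 ≤ i ≤ n+1 let f_i be the n×n minor of Φ obtained by deleting the i-th row. Then the ideal (f₁,…,f_{n+1}) generated by all maximal minors has height 2. -/
open MvPolynomial

/-- The maximal minors of an `(n+1)×n` matrix, taken with alternating signs, form a vector in the
left kernel of the matrix. -/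
theorem Matrix.vecMul_signedMaximalMinors {S : Type*} [CommRing S] {n : ℕ}
    (A : Matrix (Fin (n + 1)) (Fin n) S) :
    Matrix.vecMul (fun i : Fin (n + 1) => (-1) ^ (i : ℕ) * (A.submatrix i.succAbove id).det) A = 0 := by
  ext j
  have hdet : (Matrix.of fun i => Fin.cons (A i j) (A i) :
      Matrix (Fin (n + 1)) (Fin (n + 1)) S).det = 0 :=
    Matrix.det_zero_of_column_eq (Fin.succ_ne_zero j).symm fun i => by simp
  rw [Matrix.det_succ_column_zero] at hdet
  rw [Pi.zero_apply, ← hdet, Matrix.vecMul, dotProduct]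
  refine Finset.sum_congr rfl fun i _ => ?_
  have hsub : (Matrix.of fun i => Fin.cons (A i j) (A i) :
      Matrix (Fin (n + 1)) (Fin (n + 1)) S).submatrix i.succAbove Fin.succ =
      A.submatrix i.succAbove id := by
    ext a b
    simp
  rw [hsub]
  simp only [Matrix.of_apply, Fin.cons_zero]
  ring

/-- Over a domain, if the top left `m×m` block of an `(m+2)×(m+1)` matrix is nonsingular, then all
maximal minors vanish as soon as the two that contain this block do. -/
theorem Matrix.maximalMinors_eq_zero {S : Type*} [CommRing S] [IsDomain S] {m : ℕ}
    (A : Matrix (Fin (m + 2)) (Fin (m + 1)) S)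
    (hblock : (A.submatrix (fun i : Fin m => i.castSucc.castSucc) Fin.castSucc).det ≠ 0)
    (h₁ : (A.submatrix (Fin.last m).castSucc.succAbove id).det = 0)
    (h₂ : (A.submatrix (Fin.last (m + 1)).succAbove id).det = 0) (i : Fin (m + 2)) :
    (A.submatrix i.succAbove id).det = 0 := by
  have hker := Matrix.vecMul_signedMaximalMinors A
  have hzero := Matrix.eq_zero_of_vecMul_eq_zero hblock
    (v := fun i : Fin m => (-1) ^ (i : ℕ) *
      (A.submatrix i.castSucc.castSucc.succAbove id).det) (by
    ext j
    have hj := congrFun hker j.castSucc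
    simp only [Matrix.vecMul, dotProduct] at hj
    rw [Fin.sum_univ_castSucc, Fin.sum_univ_castSucc, h₁, h₂] at hj
    simpa [Matrix.vecMul, dotProduct] using hj)
  induction i using Fin.lastCases with
  | last => exact h₂
  | cast i =>
    induction i using Fin.lastCases with
    | last => exact h₁
    | cast i =>
      have hi := congrFun hzero i
      exact (mul_eq_zero.mp hi).resolve_left (pow_ne_zero _ (neg_ne_zero.mpr one_ne_zero))

section GenericMatrix

variable (k : Type*) [Field k] {n : ℕ}

/-- The minor of the generic `(n+1)×n` matrix obtained by deleting the `i`-th row. -/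
noncomputable def genericMaximalMinor (i : Fin (n + 1)) : MvPolynomial (Fin (n + 1) × Fin n) k :=
  ((Matrix.mvPolynomialX (Fin (n + 1)) (Fin n) k).submatrix i.succAbove id).det

theorem genericMaximalMinor_eq_rename (i : Fin (n + 1)) :
    genericMaximalMinor k i = rename (Prod.map i.succAbove id)
      (Matrix.mvPolynomialX (Fin n) (Fin n) k).det := by
  rw [genericMaximalMinor, AlgHom.map_det]
  congr 1
  ext a b
  simp

theorem genericMaximalMinor_ne_zero (i : Fin (n + 1)) : genericMaximalMinor k i ≠ 0 := by
  have hinj : Function.Injective (Prod.map i.succAbove (id : Fin n → Fin n)) :=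
    Fin.succAbove_right_injective.prodMap Function.injective_id
  rw [genericMaximalMinor_eq_rename, Ne,
    map_eq_zero_iff _ (rename_injective _ hinj)]
  exact Matrix.det_mvPolynomialX_ne_zero _ _

theorem degreeOf_genericMaximalMinor_self (i : Fin (n + 1)) (j : Fin n) :
    degreeOf (i, j) (genericMaximalMinor k i) = 0 := by
  by_contra h
  rw [← Ne, ← mem_vars_iff_degreeOf_ne_zero, genericMaximalMinor_eq_rename] at h
  obtain ⟨⟨a, b⟩, -, hab⟩ := mem_vars_rename _ _ h
  exact Fin.succAbove_ne i a (congrArg Prod.fst hab)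

theorem isUnit_of_forall_dvd_genericMaximalMinor {q : MvPolynomial (Fin (n + 1) × Fin n) k}
    (hq : ∀ i, q ∣ genericMaximalMinor k i) : IsUnit q := by
  have hq0 : q ≠ 0 := fun h =>
    genericMaximalMinor_ne_zero k (0 : Fin (n + 1)) (zero_dvd_iff.mp (h ▸ hq 0))
  have hvars : q.vars = ∅ := by
    refine Finset.eq_empty_of_forall_notMem fun ⟨i, j⟩ hij => ?_
    rw [mem_vars_iff_degreeOf_ne_zero] at hij
    obtain ⟨r, hr⟩ := hq i
    have hr0 : r ≠ 0 := by
      rintro rfl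
      exact genericMaximalMinor_ne_zero k i (by rw [hr, mul_zero])
    have hdeg := degreeOf_genericMaximalMinor_self k i j
    rw [hr, degreeOf_mul_eq hq0 hr0] at hdeg
    omega
  rw [vars_eq_empty_iff_eq_C] at hvars
  rw [hvars] at hq0 ⊢
  exact (isUnit_iff_ne_zero.mpr fun h => hq0 (by rw [h, C_0])).map C

theorem two_le_height_of_genericMaximalMinor_mem {P : Ideal (MvPolynomial (Fin (n + 1) × Fin n) k)}
    [P.IsPrime] (hP : ∀ i, genericMaximalMinor k i ∈ P) : 2 ≤ P.height := by
  by_contra! hlt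
  have hne : P.height ≠ 0 := fun h =>
    genericMaximalMinor_ne_zero k 0
      (by simpa [Ideal.height_eq_zero_iff_eq_bot.mp h] using hP 0)
  have hone : P.height = 1 :=
    le_antisymm (Order.le_of_lt_add_one (by simpa [one_add_one_eq_two] using hlt))
      (Order.one_le_iff_ne_zero.mpr hne)
  obtain ⟨q, rfl⟩ := UniqueFactorizationMonoid.isPrincipal_of_height_eq_one hone
  exact Ideal.IsPrime.ne_top ‹_› (Ideal.span_singleton_eq_top.mpr
    (isUnit_of_forall_dvd_genericMaximalMinor k fun i => Ideal.mem_span_singleton.mp (hP i)))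

theorem exists_isPrime_height_le_two_genericMaximalMinor_mem (hn : 1 ≤ n) :
    ∃ P : Ideal (MvPolynomial (Fin (n + 1) × Fin n) k), P.IsPrime ∧
      (∀ i, genericMaximalMinor k i ∈ P) ∧ P.height ≤ 2 := by
  obtain ⟨m, rfl⟩ := Nat.exists_eq_add_of_le' hn
  set Φ := Matrix.mvPolynomialX (Fin (m + 2)) (Fin (m + 1)) k with hΦ
  set B := Φ.submatrix (fun i : Fin m => i.castSucc.castSucc) Fin.castSucc with hB
  -- A point of rank `m` at which the top left block is the identity.
  let φ : MvPolynomial (Fin (m + 2) × Fin (m + 1)) k →+* k :=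
    eval fun p => if (p.1 : ℕ) = p.2 ∧ (p.2 : ℕ) < m then 1 else 0
  have hφminor (i : Fin (m + 2)) : φ (genericMaximalMinor k i) = 0 := by
    rw [genericMaximalMinor, RingHom.map_det]
    exact Matrix.det_eq_zero_of_column_eq_zero (Fin.last m) fun a => by simp [φ]
  have hφblock : φ B.det = 1 := by
    rw [RingHom.map_det, ← Matrix.det_one (n := Fin m)]
    congr 1
    ext a b
    simp [φ, hB, hΦ, Matrix.one_apply, Fin.ext_iff]
  let s : Set (MvPolynomial (Fin (m + 2) × Fin (m + 1)) k) :=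
    {genericMaximalMinor k (Fin.last m).castSucc, genericMaximalMinor k (Fin.last (m + 1))}
  have hker : (RingHom.ker φ).IsPrime := RingHom.ker_isPrime φ
  have hs : Ideal.span s ≤ RingHom.ker φ := by
    rw [Ideal.span_le]
    rintro _ (rfl | rfl) <;> exact hφminor _
  obtain ⟨P, hPmin, hPker⟩ := Ideal.exists_minimalPrimes_le hs
  have hPprime : P.IsPrime := hPmin.isPrime
  have hsP : s ⊆ P := Ideal.span_le.mp hPmin.1.2
  have hmap (i : Fin (m + 2)) : Ideal.Quotient.mk P (genericMaximalMinor k i) =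
      ((Φ.map (Ideal.Quotient.mk P)).submatrix i.succAbove id).det := by
    rw [genericMaximalMinor, RingHom.map_det]
    rfl
  refine ⟨P, hPprime, fun i => ?_, ?_⟩
  · rw [← Ideal.Quotient.eq_zero_iff_mem, hmap]
    refine Matrix.maximalMinors_eq_zero _ ?_ ?_ ?_ i
    · have hBP : Ideal.Quotient.mk P B.det ≠ 0 := by
        rw [Ne, Ideal.Quotient.eq_zero_iff_mem]
        intro h
        have hzero : φ B.det = 0 := hPker h
        exact one_ne_zero (hφblock.symm.trans hzero)
      rwa [RingHom.map_det] at hBP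
    · rw [← hmap, Ideal.Quotient.eq_zero_iff_mem]
      exact hsP (Or.inl rfl)
    · rw [← hmap, Ideal.Quotient.eq_zero_iff_mem]
      exact hsP (Or.inr rfl)
  · refine (Ideal.height_le_card_of_mem_minimalPrimes_span (Set.toFinite s) hPmin).trans ?_
    exact_mod_cast (Set.ncard_insert_le _ _).trans_eq (by rw [Set.ncard_singleton])

end GenericMatrix

/-- Let `f_i` be the `n×n` minor of the generic `(n+1)×n` matrix obtained
by deleting its `i`-th row.  Then the ideal generated by the maximal minors `f₁,…,f_{n+1}`
has height `2`. -/
theorem stmt_10 {k : Type*} [Field k] (n : ℕ) (hn : 1 ≤ n)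
    (f : Fin (n + 1) → MvPolynomial (Fin (n + 1) × Fin n) k)
    (hf : ∀ i, f i = (Matrix.of fun j j' : Fin n => X (i.succAbove j, j')).det) :
    idealHeight (Ideal.span (Set.range f)) = 2 := by
  obtain rfl : f = genericMaximalMinor k := funext hf
  apply le_antisymm
  · obtain ⟨P, hP, hmem, hle⟩ := exists_isPrime_height_le_two_genericMaximalMinor_mem k hn
    refine (iInf₂_le (⟨P, hP⟩ : PrimeSpectrum _) ?_).trans
      ((PrimeSpectrum.height_eq_orderHeight ⟨P, hP⟩).symm.trans_le hle)
    exact Ideal.span_le.mpr (Set.range_subset_iff.mpr hmem)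
  · refine le_iInf₂ fun p hp => ?_
    rw [← PrimeSpectrum.height_eq_orderHeight]
    exact two_le_height_of_genericMaximalMinor_mem k fun i =>
      hp (Ideal.subset_span (Set.mem_range_self i))
end

section
/- Let R = ℂ[x_{ij} : 1 ≤ i ≤ 4, 1 ≤ j ≤ 3] with the ℕ³ column grading in which each variable x_{ij} has degree e_j (the j-th standard basis vector). Let Δ ∈ R be homogeneous of column degree (1,1,1), and suppose Δ = a·b + c·d where a, c are homogeneous of degree 1 and b, d are homogeneous of degree 2 in the standard grading. Then there exist a′, c′ homogeneous of degree 1 and b′, d′ homogeneous of degree 2 in the standard grading, each of which is in addition homogeneous with respect to the column grading, such that Δ = a′·b′ + c′·d′. -/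
open MvPolynomial

/-- The column grading on `ℂ[x_{ij} : 1 ≤ i ≤ 4, 1 ≤ j ≤ 3]`: the variable `x_{ij}`
(written `X (i, j)`) has weight `e_j ∈ ℕ³`. -/
def colWeight : Fin 4 × Fin 3 → (Fin 3 → ℕ) := fun p => Pi.single p.2 1

section InitialForms

variable {σ K : Type*} [Field K]

lemma aeval_pow_mul_of_isWeightedHomogeneous {S : Type*} [CommRing S] [Algebra K S]
    {n : σ → ℕ} {m : ℕ} {p : MvPolynomial σ K} (hp : p.IsWeightedHomogeneous n m)
    (t : S) (y : σ → S) :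
    aeval (fun u => t ^ n u * y u) p = t ^ m * aeval y p := by
  induction hp using IsWeightedHomogeneous.induction_on with
  | zero => simp
  | add p q hp hq ihp ihq => rw [map_add, map_add, ihp, ihq, mul_add]
  | monomial d r hr =>
    rw [aeval_monomial, aeval_monomial, mul_left_comm]
    congr 1
    rw [← hr, Finsupp.weight_apply]
    simp only [Finsupp.prod, Finsupp.sum, mul_pow, Finset.prod_mul_distrib, smul_eq_mul]
    rw [← Finset.prod_pow_eq_pow_sum]
    congr 1
    exact Finset.prod_congr rfl fun u _ => by rw [← pow_mul, mul_comm]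

lemma isWeightedHomogeneous_map_weight {M N : Type*} [AddCommMonoid M] [AddCommMonoid N]
    {w : σ → M} {m : M} {p : MvPolynomial σ K} (hp : p.IsWeightedHomogeneous w m) (f : M →+ N) :
    p.IsWeightedHomogeneous (fun u => f (w u)) (f m) := by
  intro d hd
  rw [← hp hd, Finsupp.weight_apply, Finsupp.weight_apply, map_finsuppSum]
  simp only [map_nsmul]

/-- First step of row reduction of a pair of vectors. -/
lemma exists_pivot [DecidableEq σ] [Finite σ] [Nonempty σ] (n : σ → ℕ) (a c : σ → K) :
    ∃ (v : σ) (a' c' : σ → K), a' v = 1 ∧ c' v = 0 ∧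
      (∀ u, n u < n v → a' u = 0) ∧ (∀ u, n u < n v → c' u = 0) ∧
      a ∈ Submodule.span K {a', c'} ∧ c ∈ Submodule.span K {a', c'} := by
  by_cases h : ∃ u, a u ≠ 0 ∨ c u ≠ 0
  · obtain ⟨v, hv, hmin⟩ := Set.exists_min_image {u | a u ≠ 0 ∨ c u ≠ 0} n (Set.toFinite _) h
    have hmin' : ∀ u, n u < n v → a u = 0 ∧ c u = 0 := by
      intro u hu
      by_contra hne
      exact absurd (hmin u (by simp only [Set.mem_ofPred_eq]; tauto)) (not_le.2 hu)
    rcases hv with hv | hv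
    · refine ⟨v, (a v)⁻¹ • a, c - (c v * (a v)⁻¹) • a, by simp [hv], by simp [hv],
        fun u hu => by simp [hmin' u hu], fun u hu => by simp [hmin' u hu],
        Submodule.mem_span_pair.2 ⟨a v, 0, by simp [smul_smul, hv]⟩,
        Submodule.mem_span_pair.2 ⟨c v, 1, by simp [smul_smul]⟩⟩
    · refine ⟨v, (c v)⁻¹ • c, a - (a v * (c v)⁻¹) • c, by simp [hv], by simp [hv],
        fun u hu => by simp [hmin' u hu], fun u hu => by simp [hmin' u hu],
        Submodule.mem_span_pair.2 ⟨a v, 1, by simp [smul_smul]⟩,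
        Submodule.mem_span_pair.2 ⟨c v, 0, by simp [smul_smul, hv]⟩⟩
  · push Not at h
    obtain ⟨v⟩ := ‹Nonempty σ›
    have ha : a = 0 := funext fun u => (h u).1
    have hc : c = 0 := funext fun u => (h u).2
    refine ⟨v, Pi.single v 1, 0, by simp, by simp, fun u hu => ?_, by simp, by simp [ha],
      by simp [hc]⟩
    exact Pi.single_eq_of_ne (by rintro rfl; exact lt_irrefl _ hu) _

/-- Row reduction of a pair of vectors with respect to a weight on the coordinates. -/
lemma exists_rowReduced [DecidableEq σ] [Finite σ] [Nontrivial σ] (n : σ → ℕ) (a c : σ → K) :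
    ∃ (v w : σ) (a' c' : σ → K), a' v = 1 ∧ a' w = 0 ∧ c' v = 0 ∧ c' w = 1 ∧
      (∀ u, n u < n v → a' u = 0) ∧ (∀ u, n u < n w → c' u = 0) ∧
      a ∈ Submodule.span K {a', c'} ∧ c ∈ Submodule.span K {a', c'} := by
  obtain ⟨v, a₁, c₁, hav, hcv, ha, hc, hma, hmc⟩ := exists_pivot n a c
  obtain ⟨w, c₂, hcv₂, hcw₂, hc₂, hlow, r, hr⟩ : ∃ (w : σ) (c₂ : σ → K), c₂ v = 0 ∧ c₂ w = 1 ∧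
      (∀ u, n u < n w → c₂ u = 0) ∧ (∀ u, n u < n v → a₁ w * c₂ u = 0) ∧
      ∃ r : K, c₁ = r • c₂ := by
    by_cases h : ∃ u, c₁ u ≠ 0
    · obtain ⟨w, hw, hmin⟩ := Set.exists_min_image {u | c₁ u ≠ 0} n (Set.toFinite _) h
      simp only [Set.mem_ofPred_eq] at hw hmin
      refine ⟨w, (c₁ w)⁻¹ • c₁, by simp [hcv], by simp [hw], fun u hu => ?_,
        fun u hu => by simp [hc u hu], c₁ w, by simp [smul_smul, hw]⟩
      have : c₁ u = 0 := by
        by_contra hne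
        exact absurd (hmin u hne) (not_le.2 hu)
      simp [this]
    · push Not at h
      obtain ⟨w, hw⟩ := exists_ne v
      refine ⟨w, Pi.single w 1, Pi.single_eq_of_ne hw.symm _, by simp, fun u hu => ?_,
        fun u hu => ?_, 0, by simp [funext_iff, h]⟩
      · exact Pi.single_eq_of_ne (by rintro rfl; exact lt_irrefl _ hu) _
      · by_cases huw : u = w
        · subst huw
          simp [ha u hu]
        · simp [huw]
  have hle : Submodule.span K {a₁, c₁} ≤ Submodule.span K {a₁ - a₁ w • c₂, c₂} := by
    rw [Submodule.span_le, Set.pair_subset_iff]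
    exact ⟨Submodule.mem_span_pair.2 ⟨1, a₁ w, by simp⟩,
      Submodule.mem_span_pair.2 ⟨0, r, by simp [hr]⟩⟩
  refine ⟨v, w, a₁ - a₁ w • c₂, c₂, by simp [hav, hcv₂], by simp [hcw₂], hcv₂, hcw₂,
    fun u hu => ?_, hc₂, hle hma, hle hmc⟩
  simpa [ha u hu] using hlow u hu

lemma weightedHomogeneousComponent_mul_of_right {M : Type*} [AddCancelCommMonoid M]
    {w : σ → M} {i j : M} {p q : MvPolynomial σ K} (hq : q.IsWeightedHomogeneous w j) :
    weightedHomogeneousComponent w (i + j) (p * q) = weightedHomogeneousComponent w i p * q := by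
  classical
  let := weightedGradedAlgebra K w
  simp_rw [← weightedDecomposition.decompose'_apply]
  exact DirectSum.coe_decompose_mul_add_of_right_mem
    (weightedHomogeneousSubmodule K w) (a := p) (i := i) hq

variable [Fintype σ]

lemma exists_linearCombination_of_isHomogeneous_one {p : MvPolynomial σ K}
    (hp : p.IsHomogeneous 1) : ∃ a : σ → K, Fintype.linearCombination K X a = p := by
  rwa [← mem_homogeneousSubmodule, homogeneousSubmodule_one_eq_span_X,
    ← Fintype.range_linearCombination] at hp

/-- The coefficients of the part of a linear form lying in weight `k`. -/
def weightPart (n : σ → ℕ) (k : ℕ) (a : σ → K) : σ → K := fun u => if n u = k then a u else 0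

/-- The one-parameter degeneration of a linear form to its part of weight `k`. -/
noncomputable def degeneration (n : σ → ℕ) (k : ℕ) (a : σ → K) :
    Polynomial (MvPolynomial σ K) :=
  ∑ u, a u • (Polynomial.X ^ (n u - k) * Polynomial.C (X u))

lemma eval_zero_degeneration {n : σ → ℕ} {k : ℕ} {a : σ → K} (ha : ∀ u, n u < k → a u = 0) :
    (degeneration n k a).eval 0 = Fintype.linearCombination K X (weightPart n k a) := by
  rw [degeneration, Polynomial.eval_finsetSum, Fintype.linearCombination_apply]
  refine Finset.sum_congr rfl fun u _ => ?_
  rcases lt_trichotomy (n u) k with h | h | h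
  · simp [weightPart, ha u h]
  · simp [weightPart, h]
  · simp [weightPart, h.ne', (Nat.sub_pos_of_lt h).ne']

lemma sum_smul_pow_mul {n : σ → ℕ} {k : ℕ} {a : σ → K} (ha : ∀ u, n u < k → a u = 0) :
    ∑ u, a u • ((Polynomial.X : Polynomial (MvPolynomial σ K)) ^ n u * Polynomial.C (X u)) =
      Polynomial.X ^ k * degeneration n k a := by
  rw [degeneration, Finset.mul_sum]
  refine Finset.sum_congr rfl fun u _ => ?_
  rcases lt_or_ge (n u) k with h | h
  · simp [ha u h]
  · rw [mul_smul_comm, ← mul_assoc, ← pow_add, Nat.add_sub_cancel' h]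

/-- A weighted homogeneous element of the ideal of a row-reduced pair of linear forms lies in the
ideal of their lowest-weight parts. -/
lemma mem_span_weightPart [DecidableEq σ] {n : σ → ℕ} {m : ℕ} {p : MvPolynomial σ K}
    (hp : p.IsWeightedHomogeneous n m) {a c : σ → K} {v w : σ}
    (hav : a v = 1) (haw : a w = 0) (hcv : c v = 0) (hcw : c w = 1)
    (ha : ∀ u, n u < n v → a u = 0) (hc : ∀ u, n u < n w → c u = 0)
    (hmem : p ∈ Ideal.span
      {Fintype.linearCombination K X a, Fintype.linearCombination K X c}) :
    p ∈ Ideal.span {Fintype.linearCombination K X (weightPart n (n v) a),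
      Fintype.linearCombination K X (weightPart n (n w) c)} := by
  let y : σ → Polynomial (MvPolynomial σ K) := fun u =>
    Polynomial.C (X u) - (if u = v then degeneration n (n v) a else 0) -
      (if u = w then degeneration n (n w) c else 0)
  have key : ∀ e : σ → K,
      aeval (fun u => Polynomial.X ^ n u * y u)
          (Fintype.linearCombination K (X : σ → MvPolynomial σ K) e) =
        ∑ u, e u • (Polynomial.X ^ n u * Polynomial.C (X u)) -
          e v • (Polynomial.X ^ n v * degeneration n (n v) a) -
          e w • (Polynomial.X ^ n w * degeneration n (n w) c) := by
    intro e
    simp [Fintype.linearCombination_apply, y, mul_sub, smul_sub, Finset.sum_sub_distrib]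
  have hzero : aeval y p = 0 := by
    have h := aeval_pow_mul_of_isWeightedHomogeneous hp Polynomial.X y
    obtain ⟨b, d, rfl⟩ := Ideal.mem_span_pair.1 hmem
    rw [map_add, map_mul, map_mul, key a, key c, sum_smul_pow_mul ha, sum_smul_pow_mul hc,
      hav, haw, hcv, hcw] at h
    simp only [one_smul, zero_smul, sub_self, sub_zero, mul_zero, add_zero] at h
    exact (mul_eq_zero.1 h.symm).resolve_left (pow_ne_zero _ Polynomial.X_ne_zero)
  set I : Ideal (MvPolynomial σ K) := Ideal.span
    {Fintype.linearCombination K X (weightPart n (n v) a),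
      Fintype.linearCombination K X (weightPart n (n w) c)}
  have hmk : (Ideal.Quotient.mk I).comp ((Polynomial.evalRingHom 0).comp
      (aeval y : MvPolynomial σ K →ₐ[K] _).toRingHom) = Ideal.Quotient.mk I := by
    refine MvPolynomial.ringHom_ext (fun r => ?_) fun u => ?_
    · simp [algHom_C, Polynomial.algebraMap_apply]
    · have h1 : Ideal.Quotient.mk I ((degeneration n (n v) a).eval 0) = 0 := by
        rw [eval_zero_degeneration ha, Ideal.Quotient.eq_zero_iff_mem]
        exact Ideal.subset_span (by simp)
      have h2 : Ideal.Quotient.mk I ((degeneration n (n w) c).eval 0) = 0 := by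
        rw [eval_zero_degeneration hc, Ideal.Quotient.eq_zero_iff_mem]
        exact Ideal.subset_span (by simp)
      by_cases hv : u = v <;> by_cases hw : u = w <;> simp [y, hv, hw, h1, h2] <;> simp_all
  rw [← Ideal.Quotient.eq_zero_iff_mem, ← hmk]
  simp [hzero]

lemma linearCombination_mem_ideal_span {a a' c' : σ → K} (h : a ∈ Submodule.span K {a', c'}) :
    Fintype.linearCombination K (X : σ → MvPolynomial σ K) a ∈ Ideal.span
      {Fintype.linearCombination K X a', Fintype.linearCombination K X c'} := by
  obtain ⟨r, s, rfl⟩ := Submodule.mem_span_pair.1 h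
  exact Ideal.mem_span_pair.2 ⟨C r, C s, by simp [smul_eq_C_mul]⟩

lemma linearCombination_isWeightedHomogeneous {M : Type*} [AddCommMonoid M] {w : σ → M} {m : M}
    {a : σ → K} (h : ∀ u, a u ≠ 0 → w u = m) :
    (Fintype.linearCombination K (X : σ → MvPolynomial σ K) a).IsWeightedHomogeneous w m := by
  rw [Fintype.linearCombination_apply]
  refine IsWeightedHomogeneous.sum _ _ _ fun u _ => ?_
  by_cases hu : a u = 0
  · simpa [hu] using isWeightedHomogeneous_zero K w m
  · rw [smul_eq_C_mul, ← h u hu]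
    exact (isWeightedHomogeneous_X K w u).C_mul _

end InitialForms

lemma colWeight_isHomogeneous {p : MvPolynomial (Fin 4 × Fin 3) ℂ} {m : Fin 3 → ℕ}
    (hp : p.IsWeightedHomogeneous colWeight m) : p.IsHomogeneous (∑ j, m j) := by
  have h := isWeightedHomogeneous_map_weight hp
    (∑ j, Pi.evalAddMonoidHom (fun _ : Fin 3 => ℕ) j)
  simpa [IsHomogeneous, colWeight, Pi.one_def] using h

/-- If `Δ` is homogeneous of column degree `(1,1,1)` and `Δ = a·b + c·d`
with `a, c` linear and `b, d` quadric in the standard grading, then `Δ = a'·b' + c'·d'` for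
some `a', c'` linear and `b', d'` quadric that are in addition homogeneous with respect to the
column grading. -/
theorem stmt_12 (Δ a b c d : MvPolynomial (Fin 4 × Fin 3) ℂ)
    (hΔ : Δ.IsWeightedHomogeneous colWeight (fun _ => 1))
    (ha : a.IsHomogeneous 1) (hb : b.IsHomogeneous 2)
    (hc : c.IsHomogeneous 1) (hd : d.IsHomogeneous 2)
    (heq : Δ = a * b + c * d) :
    ∃ a' b' c' d' : MvPolynomial (Fin 4 × Fin 3) ℂ,
      a'.IsHomogeneous 1 ∧ b'.IsHomogeneous 2 ∧ c'.IsHomogeneous 1 ∧ d'.IsHomogeneous 2 ∧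
      (∃ va, a'.IsWeightedHomogeneous colWeight va) ∧
      (∃ vb, b'.IsWeightedHomogeneous colWeight vb) ∧
      (∃ vc, c'.IsWeightedHomogeneous colWeight vc) ∧
      (∃ vd, d'.IsWeightedHomogeneous colWeight vd) ∧
      Δ = a' * b' + c' * d' := by
  obtain ⟨α, rfl⟩ := exists_linearCombination_of_isHomogeneous_one ha
  obtain ⟨γ, rfl⟩ := exists_linearCombination_of_isHomogeneous_one hc
  let n : Fin 4 × Fin 3 → ℕ := fun u => u.2
  have hn : Δ.IsWeightedHomogeneous n 3 := by
    have h := isWeightedHomogeneous_map_weight hΔ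
      (∑ j : Fin 3, (j : ℕ) • Pi.evalAddMonoidHom (fun _ : Fin 3 => ℕ) j)
    have hw : (fun u => (∑ j : Fin 3, (j : ℕ) • Pi.evalAddMonoidHom (fun _ : Fin 3 => ℕ) j)
        (colWeight u)) = n := by
      funext ⟨i, j⟩
      fin_cases j <;> simp [colWeight, n, Fin.sum_univ_three]
    rw [hw] at h
    simpa [Fin.sum_univ_three] using h
  obtain ⟨v, w, α', γ', hav, haw, hcv, hcw, hα, hγ, hmα, hmγ⟩ := exists_rowReduced n α γ
  have hmem : Δ ∈ Ideal.span
      {Fintype.linearCombination ℂ X α', Fintype.linearCombination ℂ X γ'} := by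
    rw [heq]
    exact add_mem (Ideal.mul_mem_right _ _ (linearCombination_mem_ideal_span hmα))
      (Ideal.mul_mem_right _ _ (linearCombination_mem_ideal_span hmγ))
  obtain ⟨p, q, hpq⟩ := Ideal.mem_span_pair.1 (mem_span_weightPart hn hav haw hcv hcw hα hγ hmem)
  have hcol : ∀ (u : Fin 4 × Fin 3) (e : Fin 4 × Fin 3 → ℂ),
      (Fintype.linearCombination ℂ (X : _ → MvPolynomial (Fin 4 × Fin 3) ℂ)
        (weightPart n (n u) e)).IsWeightedHomogeneous colWeight (Pi.single u.2 1) := by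
    intro u e
    refine linearCombination_isWeightedHomogeneous fun x hx => ?_
    have hxu : n x = n u := by
      by_contra hne
      exact hx (if_neg hne)
    rw [colWeight, Fin.ext hxu]
  let compl : Fin 3 → Fin 3 → ℕ := fun j k => if k = j then 0 else 1
  have hcompl : ∀ j, compl j + Pi.single j 1 = fun _ => 1 := by
    intro j
    funext k
    by_cases h : k = j <;> simp [compl, h]
  have hlin : ∀ {f : MvPolynomial (Fin 4 × Fin 3) ℂ} {j : Fin 3},
      f.IsWeightedHomogeneous colWeight (Pi.single j 1) → f.IsHomogeneous 1 := fun hf => by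
    simpa using colWeight_isHomogeneous hf
  have hquad : ∀ (f : MvPolynomial (Fin 4 × Fin 3) ℂ) (j : Fin 3),
      (weightedHomogeneousComponent colWeight (compl j) f).IsHomogeneous 2 := fun f j => by
    have h := colWeight_isHomogeneous
      (weightedHomogeneousComponent_isWeightedHomogeneous (w := colWeight) (compl j) f)
    have hs : ∑ k, compl j k = 2 := by
      fin_cases j <;> simp [compl, Fin.sum_univ_three]
    rwa [hs] at h
  refine ⟨_, weightedHomogeneousComponent colWeight (compl v.2) p, _,
    weightedHomogeneousComponent colWeight (compl w.2) q, hlin (hcol v α'), hquad _ _,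
    hlin (hcol w γ'), hquad _ _, ⟨_, hcol v α'⟩,
    ⟨_, weightedHomogeneousComponent_isWeightedHomogeneous _ _⟩, ⟨_, hcol w γ'⟩,
    ⟨_, weightedHomogeneousComponent_isWeightedHomogeneous _ _⟩, ?_⟩
  rw [mul_comm, ← weightedHomogeneousComponent_mul_of_right (hcol v α'), hcompl,
    mul_comm (Fintype.linearCombination ℂ X (weightPart n (n w) γ')),
    ← weightedHomogeneousComponent_mul_of_right (hcol w γ'), hcompl, ← map_add, hpq,
    hΔ.weightedHomogeneousComponent_same]
end

section
/- Let R = ℂ[x_{ij} : 1 ≤ i ≤ 4, 1 ≤ j ≤ 3] be the polynomial ring in the entries of a generic 4×3 matrix M = (x_{ij}), and for i = 1, 2, 3 let Δ_i be the determinant of the 3×3 submatrix of M obtained by deleting the i-th row. Then for every (c₁,c₂,c₃) ∈ ℂ³ with (c₁,c₂,c₃) ≠ (0,0,0), the polynomial Δ = c₁Δ₁ + c₂Δ₂ + c₃Δ₃ cannot be written in the form Δ = a·b + c·d with a, c homogeneous of degree 1 and b, d homogeneous of degree 2. -/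
open MvPolynomial

/-- Two linear forms can be made to vanish by changing at most two coordinates, whose positions
do not depend on the starting vector. -/
theorem exists_pair_adjust_eq_zero {K ι : Type*} [Field K] [Fintype ι] [DecidableEq ι]
    [Nontrivial ι] (f g : (ι → K) →ₗ[K] K) :
    ∃ p q : ι, p ≠ q ∧ ∀ x : ι → K, ∃ u v : K,
      f (x + u • Pi.single p 1 + v • Pi.single q 1) = 0 ∧
      g (x + u • Pi.single p 1 + v • Pi.single q 1) = 0 := by
  by_cases h : ∃ p q : ι, f (Pi.single p 1) * g (Pi.single q 1) -
      f (Pi.single q 1) * g (Pi.single p 1) ≠ 0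
  · obtain ⟨p, q, h⟩ := h
    refine ⟨p, q, ?_, fun x => ?_⟩
    · rintro rfl
      exact h (sub_self _)
    · refine ⟨(g x * f (Pi.single q 1) - f x * g (Pi.single q 1)) /
          (f (Pi.single p 1) * g (Pi.single q 1) - f (Pi.single q 1) * g (Pi.single p 1)),
        (f x * g (Pi.single p 1) - g x * f (Pi.single p 1)) /
          (f (Pi.single p 1) * g (Pi.single q 1) - f (Pi.single q 1) * g (Pi.single p 1)),
        ?_, ?_⟩ <;> simp only [map_add, map_smul, smul_eq_mul]
      · linear_combination -f x * mul_inv_cancel₀ h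
      · linear_combination -g x * mul_inv_cancel₀ h
  · push Not at h
    have hprop (p : ι) : f (Pi.single p 1) • g = g (Pi.single p 1) • f := by
      refine LinearMap.pi_ext' fun q => LinearMap.ext_ring ?_
      simpa [sub_eq_zero, mul_comm] using h p q
    by_cases hp : ∃ p, f (Pi.single p 1) ≠ 0 ∨ g (Pi.single p 1) ≠ 0
    · obtain ⟨p, hp⟩ := hp
      obtain ⟨q, hq⟩ := exists_ne p
      refine ⟨p, q, hq.symm, fun x => ?_⟩
      have hx : f (Pi.single p 1) * g x = g (Pi.single p 1) * f x :=
        LinearMap.congr_fun (hprop p) x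
      rcases hp with hp | hp
      · refine ⟨-f x / f (Pi.single p 1), 0, ?_, ?_⟩ <;>
          simp only [map_add, map_smul, smul_eq_mul] <;> field_simp
        · ring
        · linear_combination hx
      · refine ⟨-g x / g (Pi.single p 1), 0, ?_, ?_⟩ <;>
          simp only [map_add, map_smul, smul_eq_mul] <;> field_simp
        · linear_combination -hx
        · ring
    · push Not at hp
      have hf : f = 0 := LinearMap.pi_ext' fun q => LinearMap.ext_ring (by simpa using (hp q).1)
      have hg : g = 0 := LinearMap.pi_ext' fun q => LinearMap.ext_ring (by simpa using (hp q).2)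
      obtain ⟨p, q, hpq⟩ := exists_pair_ne ι
      exact ⟨p, q, hpq, fun x => ⟨0, 0, by simp [hf], by simp [hg]⟩⟩

/-- Any two positions of a `3 × 3` matrix are avoided by a permutation which is the only one
supported on its own graph together with these two positions. -/
theorem exists_perm_isolated (p q : Fin 3 × Fin 3) :
    ∃ σ : Equiv.Perm (Fin 3), (∀ i, (σ i, i) ≠ p ∧ (σ i, i) ≠ q) ∧
      ∀ τ : Equiv.Perm (Fin 3), τ ≠ σ → ∃ i, τ i ≠ σ i ∧ (τ i, i) ≠ p ∧ (τ i, i) ≠ q := by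
  revert p q
  decide

/-- A linear space of `3 × 3` matrices cut out by two equations contains an invertible matrix. -/
theorem exists_det_ne_zero_of_two_linear_forms {K : Type*} [Field K]
    (f g : (Fin 3 × Fin 3 → K) →ₗ[K] K) :
    ∃ x : Fin 3 × Fin 3 → K, f x = 0 ∧ g x = 0 ∧
      (Matrix.of fun i j => x (i, j)).det ≠ 0 := by
  obtain ⟨p, q, -, h⟩ := exists_pair_adjust_eq_zero f g
  obtain ⟨σ, hσ, hτ⟩ := exists_perm_isolated p q
  obtain ⟨u, v, hf, hg⟩ := h fun k => if k.1 = σ k.2 then 1 else 0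
  refine ⟨_, hf, hg, ?_⟩
  rw [Matrix.det_apply, Finset.sum_eq_single σ]
  · rw [Finset.prod_eq_one fun i _ => by
      simp [Pi.single_eq_of_ne (hσ i).1, Pi.single_eq_of_ne (hσ i).2]]
    rcases Int.units_eq_one_or (Equiv.Perm.sign σ) with hs | hs <;> simp [hs]
  · intro τ _ hne
    obtain ⟨i, hi, hp, hq⟩ := hτ τ hne
    rw [Finset.prod_eq_zero (Finset.mem_univ i), smul_zero]
    simp [hi, Pi.single_eq_of_ne hp, Pi.single_eq_of_ne hq]
  · simp

/-- Evaluation of a linear form, as a linear functional. -/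
theorem exists_linearMap_eq_eval_of_isHomogeneous_one {R σ : Type*} [CommSemiring R]
    {a : MvPolynomial σ R} (ha : a.IsHomogeneous 1) :
    ∃ f : (σ → R) →ₗ[R] R, ∀ x, f x = eval x a := by
  rw [← mem_homogeneousSubmodule, homogeneousSubmodule_one_eq_span_X] at ha
  induction ha using Submodule.span_induction with
  | mem _ h =>
    obtain ⟨i, rfl⟩ := h
    exact ⟨LinearMap.proj i, by simp⟩
  | zero => exact ⟨0, by simp⟩
  | add _ _ _ _ h₁ h₂ =>
    obtain ⟨f, hf⟩ := h₁
    obtain ⟨g, hg⟩ := h₂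
    exact ⟨f + g, by simp [hf, hg]⟩
  | smul r _ _ h =>
    obtain ⟨f, hf⟩ := h
    exact ⟨r • f, by simp [hf, smul_eval]⟩

/-- For the three `3×3` minors `Δ₁, Δ₂, Δ₃` of a generic `4×3` matrix
obtained by deleting the first, second, and third row respectively, every nontrivial
`ℂ`-linear combination `c₁Δ₁ + c₂Δ₂ + c₃Δ₃` cannot be written as `a·b + c·d` with `a, c`
linear forms and `b, d` quadrics, i.e. the collective strength of `Δ₁, Δ₂, Δ₃` is at
least `2`.  Here `X (i, j)` stands for the matrix entry `x_{(i+1)(j+1)}`. -/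
theorem stmt_13 (Δ : Fin 3 → MvPolynomial (Fin 4 × Fin 3) ℂ)
    (hΔ : ∀ i : Fin 3,
      Δ i = (Matrix.of fun j j' : Fin 3 => X ((i.castSucc.succAbove j), j')).det) :
    ∀ c₁ c₂ c₃ : ℂ, (c₁, c₂, c₃) ≠ (0, 0, 0) →
      ¬ ∃ a b c d : MvPolynomial (Fin 4 × Fin 3) ℂ,
          a.IsHomogeneous 1 ∧ c.IsHomogeneous 1 ∧ b.IsHomogeneous 2 ∧ d.IsHomogeneous 2 ∧
          c₁ • Δ 0 + c₂ • Δ 1 + c₃ • Δ 2 = a * b + c * d := by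
  rintro c₁ c₂ c₃ hc ⟨a, b, c, d, ha, hc', -, -, h⟩
  obtain ⟨i, hi⟩ : ∃ i, (![c₁, c₂, c₃] : Fin 3 → ℂ) i ≠ 0 := by
    by_contra! h0
    exact hc (by simpa using And.intro (h0 0) (And.intro (h0 1) (h0 2)))
  obtain ⟨f, hf⟩ := exists_linearMap_eq_eval_of_isHomogeneous_one ha
  obtain ⟨g, hg⟩ := exists_linearMap_eq_eval_of_isHomogeneous_one hc'
  let s : Fin 3 × Fin 3 → Fin 4 × Fin 3 := Prod.map i.castSucc.succAbove id
  have hs : s.Injective := Fin.succAbove_right_injective.prodMap Function.injective_id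
  let L := Function.ExtendByZero.linearMap ℂ s
  obtain ⟨x, hfx, hgx, hdet⟩ := exists_det_ne_zero_of_two_linear_forms (f ∘ₗ L) (g ∘ₗ L)
  have heval (k : Fin 3) : eval (L x) (Δ k) =
      (Matrix.of fun j j' => L x (k.castSucc.succAbove j, j')).det := by
    rw [hΔ, RingHom.map_det]
    congr 1
    ext
    simp
  have hsame : eval (L x) (Δ i) = (Matrix.of fun j j' => x (j, j')).det := by
    rw [heval]
    congr 1
    ext j j'
    exact hs.extend_apply x 0 (j, j')
  have hother (k : Fin 3) (hk : k ≠ i) : eval (L x) (Δ k) = 0 := by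
    obtain ⟨j, hj⟩ := Fin.exists_succAbove_eq (x := i.castSucc) (y := k.castSucc)
      (by simpa using hk.symm)
    rw [heval]
    refine Matrix.det_eq_zero_of_row_eq_zero j fun j' => ?_
    rw [Matrix.of_apply, hj]
    refine Function.extend_apply' _ _ _ ?_
    rintro ⟨⟨m, m'⟩, hm⟩
    exact Fin.succAbove_ne _ _ (congrArg Prod.fst hm)
  have hsum : ∑ k, (![c₁, c₂, c₃] : Fin 3 → ℂ) k * eval (L x) (Δ k) = 0 := by
    have h' := congrArg (eval (L x)) h
    simp only [LinearMap.comp_apply] at hfx hgx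
    simpa [Fin.sum_univ_three, smul_eval, ← hf, ← hg, hfx, hgx] using h'
  rw [Finset.sum_eq_single i (fun k _ hk => by rw [hother k hk, mul_zero]) (by simp), hsame] at hsum
  exact mul_ne_zero hi hdet hsum
end

section
/- Let R = ℂ[x_{ij} : 1 ≤ i ≤ 4, 1 ≤ j ≤ 3] be the polynomial ring in the entries of a generic 4×3 matrix M = (x_{ij}), and for i = 1, 2, 3 let Δ_i be the determinant of the 3×3 submatrix of M obtained by deleting the i-th row. Then for every (c₁,c₂,c₃) ∈ ℂ³ with (c₁,c₂,c₃) ≠ (0,0,0), the polynomial Δ = c₁Δ₁ + c₂Δ₂ + c₃Δ₃ does not belong to any of the three ideals (x₁₁, x₁₂), (x₁₁, x₂₁), and (x₁₁, x₂₂) of R. -/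
open MvPolynomial

/-- A polynomial in the ideal generated by two variables vanishes wherever both variables do. -/
theorem eval_eq_zero_of_mem_span_X_pair {σ R : Type*} [CommRing R] {a b : σ}
    {p : MvPolynomial σ R} (hp : p ∈ Ideal.span {X a, X b}) {v : σ → R}
    (ha : v a = 0) (hb : v b = 0) : eval v p = 0 := by
  obtain ⟨f, g, rfl⟩ := Ideal.mem_span_pair.1 hp
  simp [ha, hb]

/-- A linear combination of the three minors evaluates at a matrix `M` to the same combination of
the minors of `M`. -/
theorem eval_smul_minors {R : Type*} [CommRing R] (Δ : Fin 3 → MvPolynomial (Fin 4 × Fin 3) R)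
    (hΔ : ∀ i : Fin 3,
      Δ i = (Matrix.of fun j j' : Fin 3 => X ((i.castSucc.succAbove j), j')).det)
    (c₁ c₂ c₃ : R) (M : Matrix (Fin 4) (Fin 3) R) :
    eval (fun q => M q.1 q.2) (c₁ • Δ 0 + c₂ • Δ 1 + c₃ • Δ 2) =
      c₁ * !![M 1 0, M 1 1, M 1 2; M 2 0, M 2 1, M 2 2; M 3 0, M 3 1, M 3 2].det +
      c₂ * !![M 0 0, M 0 1, M 0 2; M 2 0, M 2 1, M 2 2; M 3 0, M 3 1, M 3 2].det +
      c₃ * !![M 0 0, M 0 1, M 0 2; M 1 0, M 1 1, M 1 2; M 3 0, M 3 1, M 3 2].det := by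
  simp [hΔ, Matrix.det_fin_three, Fin.succAbove, Fin.lt_def, smul_eval]

/-- For the three `3×3` minors `Δ₁, Δ₂, Δ₃` of a generic `4×3` matrix
obtained by deleting the first, second, and third row respectively, every nontrivial
`ℂ`-linear combination `c₁Δ₁ + c₂Δ₂ + c₃Δ₃` lies in none of the three ideals
`(x₁₁, x₁₂)`, `(x₁₁, x₂₁)` and `(x₁₁, x₂₂)`.
Here `X (i, j)` stands for the matrix entry `x_{(i+1)(j+1)}`. -/
theorem stmt_15 (Δ : Fin 3 → MvPolynomial (Fin 4 × Fin 3) ℂ)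
    (hΔ : ∀ i : Fin 3,
      Δ i = (Matrix.of fun j j' : Fin 3 => X ((i.castSucc.succAbove j), j')).det) :
    ∀ c₁ c₂ c₃ : ℂ, (c₁, c₂, c₃) ≠ (0, 0, 0) →
      c₁ • Δ 0 + c₂ • Δ 1 + c₃ • Δ 2 ∉
        Ideal.span {X ((0 : Fin 4), (0 : Fin 3)), X ((0 : Fin 4), (1 : Fin 3))} ∧
      c₁ • Δ 0 + c₂ • Δ 1 + c₃ • Δ 2 ∉
        Ideal.span {X ((0 : Fin 4), (0 : Fin 3)), X ((1 : Fin 4), (0 : Fin 3))} ∧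
      c₁ • Δ 0 + c₂ • Δ 1 + c₃ • Δ 2 ∉
        Ideal.span {X ((0 : Fin 4), (0 : Fin 3)), X ((1 : Fin 4), (1 : Fin 3))} := by
  intro c₁ c₂ c₃ hc
  have key := eval_smul_minors Δ hΔ c₁ c₂ c₃
  refine ⟨fun h => hc ?_, fun h => hc ?_, fun h => hc ?_⟩
  · have h1 := (key !![0, 0, 0; 1, 0, 0; 0, 1, 0; 0, 0, 1]).symm.trans
      (eval_eq_zero_of_mem_span_X_pair h (by simp) (by simp))
    have h2 := (key !![0, 0, 1; 0, 0, 0; 1, 0, 0; 0, 1, 0]).symm.trans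
      (eval_eq_zero_of_mem_span_X_pair h (by simp) (by simp))
    have h3 := (key !![0, 0, 1; 1, 0, 0; 0, 0, 0; 0, 1, 0]).symm.trans
      (eval_eq_zero_of_mem_span_X_pair h (by simp) (by simp))
    simp [Matrix.det_fin_three] at h1 h2 h3
    simp [h1, h2, h3]
  · have h1 := (key !![0, 0, 0; 0, 1, 0; 0, 0, 1; 1, 0, 0]).symm.trans
      (eval_eq_zero_of_mem_span_X_pair h (by simp) (by simp))
    have h2 := (key !![0, 1, 0; 0, 0, 0; 0, 0, 1; 1, 0, 0]).symm.trans
      (eval_eq_zero_of_mem_span_X_pair h (by simp) (by simp))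
    have h3 := (key !![0, 1, 0; 0, 0, 1; 0, 0, 0; 1, 0, 0]).symm.trans
      (eval_eq_zero_of_mem_span_X_pair h (by simp) (by simp))
    simp [Matrix.det_fin_three] at h1 h2 h3
    simp [h1, h2, h3]
  · have h1 := (key !![0, 0, 0; 0, 0, 1; 0, 1, 0; 1, 0, 0]).symm.trans
      (eval_eq_zero_of_mem_span_X_pair h (by simp) (by simp))
    have h2 := (key !![0, 0, 1; 0, 0, 0; 0, 1, 0; 1, 0, 0]).symm.trans
      (eval_eq_zero_of_mem_span_X_pair h (by simp) (by simp))
    have h3 := (key !![0, 0, 1; 1, 0, 0; 0, 0, 0; 0, 1, 0]).symm.trans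
      (eval_eq_zero_of_mem_span_X_pair h (by simp) (by simp))
    simp [Matrix.det_fin_three] at h1 h2 h3
    simp [h1, h2, h3]
end
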